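/- Let n ≥ k ≥ 1, p ∈ (0,1), d ≥ 1, and let C̃ be any depth-d noisy circuit on n qubits with depolarizing noise of strength p (arbitrary, possibly non-local, unitary layers). Let ℰ be the encoding channel ℰ(ζ) = C̃(ζ ⊗ (|0⟩⟨0|)^{⊗(n−k)}) from k-qubit states to n-qubit states. Then the coherent information on the maximally mixed input satisfies I_c ≤ e^{−p d}(n + k) − k. -/

import Mathlib

open Matrix

noncomputable section

/-- Partial trace over the first (reference) tensor factor. -/
def ptraceFirst {R B : Type*} [Fintype R] (M : Matrix (R × B) (R × B) ℂ) : Matrix B B ℂ :=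
  Matrix.of fun b b' => ∑ r, M (r, b) (r, b')

/-- Density matrix of the maximally entangled state `|Φ⟩ = (card A)^{-1/2} ∑ᵢ |i⟩⊗|i⟩`. -/
def maxEnt (A : Type*) [Fintype A] [DecidableEq A] : Matrix (A × A) (A × A) ℂ :=
  Matrix.of fun x y => if x.1 = x.2 ∧ y.1 = y.2 then ((Fintype.card A : ℂ))⁻¹ else 0

/-- The map `Id ⊗ ℰ` acting on operators on `R ⊗ A`, defined entrywise. -/
def idTensor {R A B : Type*} (E : Matrix A A ℂ → Matrix B B ℂ)
    (M : Matrix (R × A) (R × A) ℂ) : Matrix (R × B) (R × B) ℂ :=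
  Matrix.of fun x y => E (Matrix.of fun a a' => M (x.1, a) (y.1, a')) x.2 y.2

/-- Von Neumann entropy in bits, `S(ρ) = -Tr[ρ log₂ ρ]`, via the eigenvalues of `ρ`
(with the convention `0 log 0 = 0`). -/
def vN {ι : Type*} [Fintype ι] [DecidableEq ι] (ρ : Matrix ι ι ℂ) : ℝ :=
  if h : ρ.IsHermitian then -∑ i, (h.eigenvalues i) * Real.logb 2 (h.eigenvalues i) else 0

/-- Coherent information of a channel on the maximally mixed input:
`I_c = S(ρ_B) − S(ρ_RB)` where `ρ_RB = (Id ⊗ ℰ)(|Φ⟩⟨Φ|)`. -/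
def cohInfo {A B : Type*} [Fintype A] [DecidableEq A] [Fintype B] [DecidableEq B]
    (E : Matrix A A ℂ → Matrix B B ℂ) : ℝ :=
  vN (ptraceFirst (idTensor (R := A) E (maxEnt A))) - vN (idTensor (R := A) E (maxEnt A))

/-- Hilbert-space index for `n` qubits. -/
abbrev QSpace (n : ℕ) := Fin n → Fin 2

/-- The Pauli matrices `I, X, Y, Z` indexed by `Fin 4`. -/
def pauli (s : Fin 4) : Matrix (Fin 2) (Fin 2) ℂ :=
  if s = 0 then 1
  else if s = 1 then !![0, 1; 1, 0]
  else if s = 2 then !![0, -Complex.I; Complex.I, 0]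
  else !![1, 0; 0, -1]

/-- Probability weights of the depolarizing channel of strength `p`:
`1 − p` for `I` and `p/3` for each of `X, Y, Z`. -/
def pauliWeight (p : ℝ) (s : Fin 4) : ℝ := if s = 0 then 1 - p else p / 3

/-- A tensor product of Pauli matrices over the `n` qubits. -/
def pauliString {n : ℕ} (s : Fin n → Fin 4) : Matrix (QSpace n) (QSpace n) ℂ :=
  Matrix.of fun x y => ∏ i, pauli (s i) (x i) (y i)

/-- `D_p^{⊗n}`: one layer of single-qubit depolarizing noise of strength `p`
acting independently on each of the `n` qubits. -/
def depolLayer {n : ℕ} (p : ℝ) (ρ : Matrix (QSpace n) (QSpace n) ℂ) :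
    Matrix (QSpace n) (QSpace n) ℂ :=
  ∑ s : Fin n → Fin 4, ((∏ i, pauliWeight p (s i) : ℝ) : ℂ) • (pauliString s * ρ * (pauliString s)ᴴ)

/-- The depth-`d` noisy circuit `C̃ = D_p^{⊗n} ∘ 𝒰_d ∘ ⋯ ∘ D_p^{⊗n} ∘ 𝒰_1`,
where `𝒰_i(ρ) = U_i ρ U_i†`. -/
def noisyCircuit {n : ℕ} (p : ℝ) {d : ℕ} (U : Fin d → Matrix (QSpace n) (QSpace n) ℂ)
    (ρ : Matrix (QSpace n) (QSpace n) ℂ) : Matrix (QSpace n) (QSpace n) ℂ :=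
  (List.ofFn U).foldl (fun σ V => depolLayer p (V * σ * Vᴴ)) ρ

/-- The encoding channel `ℰ(ζ) = C(ζ ⊗ (|0⟩⟨0|)^{⊗(n−k)})`, where the first `k` qubits
carry the logical state `ζ` and the remaining `n − k` qubits are ancillas in `|0⟩`. -/
def encode {n k : ℕ} (hk : k ≤ n)
    (C : Matrix (QSpace n) (QSpace n) ℂ → Matrix (QSpace n) (QSpace n) ℂ)
    (ζ : Matrix (QSpace k) (QSpace k) ℂ) : Matrix (QSpace n) (QSpace n) ℂ :=
  C (Matrix.of fun x y =>
    (∏ i : Fin n, if (i : ℕ) < k then (1 : ℂ) else (if x i = 0 ∧ y i = 0 then 1 else 0)) *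
      ζ (fun j => x (Fin.castLE hk j)) (fun j => y (Fin.castLE hk j)))

section Preliminaries

open MeasureTheory intervalIntegral
open scoped ComplexOrder

section Spectral

variable {ι : Type*} [Fintype ι] [DecidableEq ι] {A B : Matrix ι ι ℂ}

/-- The matrix `X` written in an eigenbasis of `A` on the left and of `B` on the right. -/
def eigCoord (hA : A.IsHermitian) (hB : B.IsHermitian) (X : Matrix ι ι ℂ) : Matrix ι ι ℂ :=
  (hA.eigenvectorUnitary : Matrix ι ι ℂ)ᴴ * X * (hB.eigenvectorUnitary : Matrix ι ι ℂ)

lemma cfc_eq_mul_diagonal_mul (hA : A.IsHermitian) (f : ℝ → ℝ) :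
    cfc f A = (hA.eigenvectorUnitary : Matrix ι ι ℂ) *
      diagonal (fun i => ((f (hA.eigenvalues i) : ℝ) : ℂ)) *
        (hA.eigenvectorUnitary : Matrix ι ι ℂ)ᴴ := by
  rw [hA.cfc_eq, IsHermitian.cfc, Unitary.conjStarAlgAut_apply]
  rfl

lemma trace_cfc_mul_cfc (hA : A.IsHermitian) (hB : B.IsHermitian) (f g : ℝ → ℝ)
    (Y Z : Matrix ι ι ℂ) :
    trace (Yᴴ * cfc f A * Z * cfc g B) =
      ∑ i, ∑ j, star (eigCoord hA hB Y i j) * eigCoord hA hB Z i j *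
        ((f (hA.eigenvalues i) * g (hB.eigenvalues j) : ℝ) : ℂ) := by
  have h1 : trace (Yᴴ * cfc f A * Z * cfc g B) =
      trace ((eigCoord hA hB Y)ᴴ * diagonal (fun i => ((f (hA.eigenvalues i) : ℝ) : ℂ)) *
        (eigCoord hA hB Z) * diagonal (fun i => ((g (hB.eigenvalues i) : ℝ) : ℂ))) := by
    rw [cfc_eq_mul_diagonal_mul hA, cfc_eq_mul_diagonal_mul hB]
    simp only [eigCoord, conjTranspose_mul, conjTranspose_conjTranspose, ← Matrix.mul_assoc]
    rw [trace_mul_comm]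
    simp only [← Matrix.mul_assoc]
  rw [h1, trace, Finset.sum_comm]
  refine Finset.sum_congr rfl fun j _ => ?_
  rw [diag_apply, mul_diagonal, mul_apply, Finset.sum_mul]
  refine Finset.sum_congr rfl fun i _ => ?_
  rw [mul_diagonal, conjTranspose_apply]
  push_cast
  ring

lemma re_trace_cfc_mul_cfc (hA : A.IsHermitian) (hB : B.IsHermitian) (f g : ℝ → ℝ)
    (Y : Matrix ι ι ℂ) :
    (trace (Yᴴ * cfc f A * Y * cfc g B)).re =
      ∑ i, ∑ j, Complex.normSq (eigCoord hA hB Y i j) *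
        (f (hA.eigenvalues i) * g (hB.eigenvalues j)) := by
  rw [trace_cfc_mul_cfc hA hB, Complex.re_sum]
  refine Finset.sum_congr rfl fun i _ => ?_
  rw [Complex.re_sum]
  refine Finset.sum_congr rfl fun j _ => ?_
  rw [Complex.star_def, ← Complex.normSq_eq_conj_mul_self, ← Complex.ofReal_mul, Complex.ofReal_re]

lemma cfc_one_fun (hA : A.IsHermitian) : cfc (fun _ : ℝ => (1 : ℝ)) A = 1 :=
  cfc_const_one ℝ A hA.isSelfAdjoint

lemma cfc_id_fun (hA : A.IsHermitian) : cfc (fun x : ℝ => x) A = A :=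
  cfc_id' ℝ A hA.isSelfAdjoint

/-- The quadratic form `Y ↦ v ⟨Y, A Y⟩ + (1 - v) ⟨Y, Y B⟩` in the Hilbert–Schmidt product. -/
def mixForm (A B : Matrix ι ι ℂ) (v : ℝ) (Y : Matrix ι ι ℂ) : ℝ :=
  v * (trace (Yᴴ * A * Y)).re + (1 - v) * (trace (Yᴴ * Y * B)).re

/-- The quadratic form in `X` dual to `mixForm A B v`. -/
def dualForm (hA : A.IsHermitian) (hB : B.IsHermitian) (X : Matrix ι ι ℂ) (v : ℝ) : ℝ :=
  ∑ i, ∑ j, Complex.normSq (eigCoord hA hB X i j) *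
    (v * hA.eigenvalues i + (1 - v) * hB.eigenvalues j)⁻¹

lemma mixForm_eq (hA : A.IsHermitian) (hB : B.IsHermitian) (v : ℝ) (Y : Matrix ι ι ℂ) :
    mixForm A B v Y = ∑ i, ∑ j, Complex.normSq (eigCoord hA hB Y i j) *
      (v * hA.eigenvalues i + (1 - v) * hB.eigenvalues j) := by
  have h1 := re_trace_cfc_mul_cfc hA hB (fun x => x) (fun _ => 1) Y
  have h2 := re_trace_cfc_mul_cfc hA hB (fun _ => 1) (fun x => x) Y
  rw [cfc_id_fun hA, cfc_one_fun hB, Matrix.mul_one] at h1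
  rw [cfc_id_fun hB, cfc_one_fun hA, Matrix.mul_one] at h2
  rw [mixForm, h1, h2]
  simp only [Finset.mul_sum, ← Finset.sum_add_distrib]
  refine Finset.sum_congr rfl fun i _ => Finset.sum_congr rfl fun j _ => ?_
  ring

lemma re_trace_conjTranspose_mul (hA : A.IsHermitian) (hB : B.IsHermitian)
    (Y X : Matrix ι ι ℂ) :
    (trace (Yᴴ * X)).re =
      ∑ i, ∑ j, (star (eigCoord hA hB Y i j) * eigCoord hA hB X i j).re := by
  have h := trace_cfc_mul_cfc hA hB (fun _ => 1) (fun _ => 1) Y X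
  rw [cfc_one_fun hA, cfc_one_fun hB, Matrix.mul_one, Matrix.mul_one] at h
  rw [h, Complex.re_sum]
  refine Finset.sum_congr rfl fun i _ => ?_
  rw [Complex.re_sum]
  simp

lemma mix_eigenvalues_pos (hA : A.PosDef) (hB : B.PosDef) {v : ℝ} (hv : v ∈ Set.Icc (0 : ℝ) 1)
    (i j : ι) : 0 < v * hA.1.eigenvalues i + (1 - v) * hB.1.eigenvalues j := by
  have ha := hA.eigenvalues_pos i
  have hb := hB.eigenvalues_pos j
  rcases eq_or_lt_of_le hv.1 with h | h
  · rw [← h]; simpa using hb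
  · have := mul_pos h ha
    have := mul_nonneg (sub_nonneg.2 hv.2) hb.le
    linarith

lemma two_mul_re_star_mul_le (y x : ℂ) {c : ℝ} (hc : 0 < c) :
    2 * (star y * x).re - Complex.normSq y * c ≤ Complex.normSq x * c⁻¹ := by
  have h : 0 ≤ ((c * y.re - x.re) ^ 2 + (c * y.im - x.im) ^ 2) * c⁻¹ := by positivity
  have h2 : ((c * y.re - x.re) ^ 2 + (c * y.im - x.im) ^ 2) * c⁻¹ =
      Complex.normSq x * c⁻¹ - (2 * (star y * x).re - Complex.normSq y * c) := by
    simp only [Complex.normSq_apply, Complex.star_def, Complex.mul_re, Complex.conj_re,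
      Complex.conj_im]
    field_simp
    ring
  linarith

lemma two_mul_trace_sub_mixForm_le (hA : A.PosDef) (hB : B.PosDef) {v : ℝ}
    (hv : v ∈ Set.Icc (0 : ℝ) 1) (X Y : Matrix ι ι ℂ) :
    2 * (trace (Yᴴ * X)).re - mixForm A B v Y ≤ dualForm hA.1 hB.1 X v := by
  rw [re_trace_conjTranspose_mul hA.1 hB.1, mixForm_eq hA.1 hB.1, dualForm]
  simp only [Finset.mul_sum, ← Finset.sum_sub_distrib]
  exact Finset.sum_le_sum fun i _ => Finset.sum_le_sum fun j _ =>
    two_mul_re_star_mul_le _ _ (mix_eigenvalues_pos hA hB hv i j)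

lemma exists_dualForm_eq (hA : A.PosDef) (hB : B.PosDef) {v : ℝ}
    (hv : v ∈ Set.Icc (0 : ℝ) 1) (X : Matrix ι ι ℂ) :
    ∃ Y, dualForm hA.1 hB.1 X v = 2 * (trace (Yᴴ * X)).re - mixForm A B v Y := by
  let T : Matrix ι ι ℂ := Matrix.of fun i j => eigCoord hA.1 hB.1 X i j *
    (((v * hA.1.eigenvalues i + (1 - v) * hB.1.eigenvalues j)⁻¹ : ℝ) : ℂ)
  let U : Matrix ι ι ℂ := hA.1.eigenvectorUnitary
  let V : Matrix ι ι ℂ := hB.1.eigenvectorUnitary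
  have hU : Uᴴ * U = 1 := Unitary.coe_star_mul_self hA.1.eigenvectorUnitary
  have hV : Vᴴ * V = 1 := Unitary.coe_star_mul_self hB.1.eigenvectorUnitary
  have hT : eigCoord hA.1 hB.1 (U * T * Vᴴ) = T := by
    change Uᴴ * (U * T * Vᴴ) * V = T
    rw [Matrix.mul_assoc, Matrix.mul_assoc (U * T), hV, Matrix.mul_one, ← Matrix.mul_assoc, hU,
      Matrix.one_mul]
  refine ⟨U * T * Vᴴ, ?_⟩
  rw [re_trace_conjTranspose_mul hA.1 hB.1, mixForm_eq hA.1 hB.1, dualForm, hT]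
  simp only [Finset.mul_sum, ← Finset.sum_sub_distrib]
  refine Finset.sum_congr rfl fun i _ => Finset.sum_congr rfl fun j _ => ?_
  have hc := (mix_eigenvalues_pos hA hB hv i j).ne'
  simp only [T, of_apply, Complex.normSq_apply, Complex.star_def, Complex.mul_re, Complex.conj_re,
      Complex.conj_im, Complex.mul_im, Complex.ofReal_re, Complex.ofReal_im]
  field_simp
  ring

lemma dualForm_nonneg (hA : A.PosDef) (hB : B.PosDef) {v : ℝ}
    (hv : v ∈ Set.Icc (0 : ℝ) 1) (X : Matrix ι ι ℂ) : 0 ≤ dualForm hA.1 hB.1 X v :=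
  Finset.sum_nonneg fun i _ => Finset.sum_nonneg fun j _ =>
    mul_nonneg (Complex.normSq_nonneg _) (inv_nonneg.2 (mix_eigenvalues_pos hA hB hv i j).le)

lemma continuousOn_dualForm (hA : A.PosDef) (hB : B.PosDef) (X : Matrix ι ι ℂ) :
    ContinuousOn (dualForm hA.1 hB.1 X) (Set.Icc 0 1) := by
  unfold dualForm
  refine continuousOn_finsetSum _ fun i _ => continuousOn_finsetSum _ fun j _ => ?_
  refine ContinuousOn.mul continuousOn_const (ContinuousOn.inv₀ (by fun_prop) fun v hv => ?_)
  exact (mix_eigenvalues_pos hA hB hv i j).ne'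

lemma dualForm_le_of_mixForm_le {A' B' : Matrix ι ι ℂ} (hA : A.PosDef) (hB : B.PosDef)
    (hA' : A'.PosDef) (hB' : B'.PosDef) {v : ℝ} (hv : v ∈ Set.Icc (0 : ℝ) 1)
    (X : Matrix ι ι ℂ) {κ : ℝ} (hκ : 0 < κ)
    (h : ∀ Y, mixForm A' B' v Y ≤ κ * mixForm A B v Y) :
    dualForm hA.1 hB.1 X v ≤ κ * dualForm hA'.1 hB'.1 X v := by
  obtain ⟨Y, hY⟩ := exists_dualForm_eq hA hB hv X
  have h1 := two_mul_trace_sub_mixForm_le hA' hB' hv X ((κ⁻¹ : ℂ) • Y)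
  have h2 := h Y
  have h3 : mixForm A' B' v ((κ⁻¹ : ℂ) • Y) = κ⁻¹ ^ 2 * mixForm A' B' v Y := by
    simp only [mixForm, conjTranspose_smul, Matrix.smul_mul, Matrix.mul_smul, trace_smul, smul_eq_mul]
    rw [← Complex.ofReal_inv]
    simp only [Complex.star_def, Complex.conj_ofReal, Complex.re_ofReal_mul]
    ring
  have h4 : (trace (((κ⁻¹ : ℂ) • Y)ᴴ * X)).re = κ⁻¹ * (trace (Yᴴ * X)).re := by
    simp only [conjTranspose_smul, Matrix.smul_mul, trace_smul, smul_eq_mul]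
    rw [← Complex.ofReal_inv]
    simp only [Complex.star_def, Complex.conj_ofReal, Complex.re_ofReal_mul]
  rw [h3, h4] at h1
  have h5 := mul_le_mul_of_nonneg_left h1 hκ.le
  have h6 : κ * (2 * (κ⁻¹ * (trace (Yᴴ * X)).re) - κ⁻¹ ^ 2 * mixForm A' B' v Y) =
      2 * (trace (Yᴴ * X)).re - κ⁻¹ * mixForm A' B' v Y := by
    field_simp
  have h7 : κ⁻¹ * mixForm A' B' v Y ≤ mixForm A B v Y := by
    rw [inv_mul_le_iff₀ hκ]; exact h2
  linarith

lemma mixForm_le_of_posSemidef {A' B' : Matrix ι ι ℂ} {κ : ℝ}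
    (hA : ((κ : ℂ) • A - A').PosSemidef) (hB : ((κ : ℂ) • B - B').PosSemidef) {v : ℝ}
    (hv : v ∈ Set.Icc (0 : ℝ) 1) (Y : Matrix ι ι ℂ) :
    mixForm A' B' v Y ≤ κ * mixForm A B v Y := by
  have h1 := (Complex.nonneg_iff.1 (hA.conjTranspose_mul_mul_same Y).trace_nonneg).1
  have h2 := (Complex.nonneg_iff.1 (hB.mul_mul_conjTranspose_same Y).trace_nonneg).1
  rw [trace_mul_comm, ← Matrix.mul_assoc] at h2
  simp only [Matrix.mul_sub, Matrix.sub_mul, trace_sub, Matrix.mul_smul, Matrix.smul_mul, trace_smul,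
    smul_eq_mul, Complex.sub_re, Complex.re_ofReal_mul] at h1 h2
  have := mul_nonneg hv.1 h1
  have := mul_nonneg (sub_nonneg.2 hv.2) h2
  unfold mixForm
  linarith

end Spectral

section RelativeEntropy

variable {ι : Type*} [Fintype ι] [DecidableEq ι] {A B : Matrix ι ι ℂ}

lemma mix_pos {a b v : ℝ} (ha : 0 < a) (hb : 0 < b) (hv : v ∈ Set.Icc (0 : ℝ) 1) :
    0 < v * a + (1 - v) * b := by
  rcases eq_or_lt_of_le hv.1 with h | h
  · rw [← h]; simpa using hb
  · have := mul_pos h ha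
    have := mul_nonneg (sub_nonneg.2 hv.2) hb.le
    linarith

lemma continuousOn_inv_mix {a b : ℝ} (ha : 0 < a) (hb : 0 < b) :
    ContinuousOn (fun v : ℝ => (v * a + (1 - v) * b)⁻¹) (Set.Icc 0 1) :=
  ContinuousOn.inv₀ (by fun_prop) fun _ hv => (mix_pos ha hb hv).ne'

lemma hasDerivAt_log_mix {a b v : ℝ} (ha : 0 < a) (hb : 0 < b) (hv : v ∈ Set.Icc (0 : ℝ) 1) :
    HasDerivAt (fun v : ℝ => Real.log (v * a + (1 - v) * b))
      ((a - b) * (v * a + (1 - v) * b)⁻¹) v := by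
  have h : HasDerivAt (fun v : ℝ => v * a + (1 - v) * b) (a - b) v := by
    have h1 := ((hasDerivAt_id v).mul_const a).add (((hasDerivAt_id v).const_sub 1).mul_const b)
    exact h1.congr_deriv (by ring)
  simpa [div_eq_mul_inv] using h.log (mix_pos ha hb hv).ne'

lemma integral_sq_mul_inv_mix {a b : ℝ} (ha : 0 < a) (hb : 0 < b) :
    ∫ v in (0 : ℝ)..1, (a - b) ^ 2 * (v * a + (1 - v) * b)⁻¹ =
      (a - b) * (Real.log a - Real.log b) := by
  have h := integral_eq_sub_of_hasDerivAt (a := (0 : ℝ)) (b := 1)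
    (f := fun v => (a - b) * Real.log (v * a + (1 - v) * b))
    (f' := fun v => (a - b) ^ 2 * (v * a + (1 - v) * b)⁻¹) ?_ ?_
  · rw [h]; simp; ring
  · intro v hv
    rw [Set.uIcc_of_le zero_le_one] at hv
    exact ((hasDerivAt_log_mix ha hb hv).const_mul (a - b)).congr_deriv (by ring)
  · apply ContinuousOn.intervalIntegrable
    rw [Set.uIcc_of_le zero_le_one]
    exact continuousOn_const.mul (continuousOn_inv_mix ha hb)

lemma integral_one_sub_mul_sq_mul_inv_mix {a b : ℝ} (ha : 0 < a) (hb : 0 < b) :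
    ∫ v in (0 : ℝ)..1, (1 - v) * ((a - b) ^ 2 * (v * a + (1 - v) * b)⁻¹) =
      a * (Real.log a - Real.log b) - a + b := by
  have h := integral_eq_sub_of_hasDerivAt (a := (0 : ℝ)) (b := 1)
    (f := fun v => a * Real.log (v * a + (1 - v) * b) - v * (a - b))
    (f' := fun v => (1 - v) * ((a - b) ^ 2 * (v * a + (1 - v) * b)⁻¹)) ?_ ?_
  · rw [h]; simp; ring
  · intro v hv
    rw [Set.uIcc_of_le zero_le_one] at hv
    refine (((hasDerivAt_log_mix ha hb hv).const_mul a).sub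
      ((hasDerivAt_id v).mul_const (a - b))).congr_deriv ?_
    linear_combination (a - b) * mul_inv_cancel₀ (mix_pos ha hb hv).ne'
  · apply ContinuousOn.intervalIntegrable
    rw [Set.uIcc_of_le zero_le_one]
    exact (by fun_prop : ContinuousOn (fun v : ℝ => 1 - v) _).mul
      (continuousOn_const.mul (continuousOn_inv_mix ha hb))

/-- Umegaki's relative entropy in nats, for positive definite matrices of arbitrary trace. -/
def relEnt (A B : Matrix ι ι ℂ) : ℝ :=
  (trace (A * (cfc Real.log A - cfc Real.log B))).re - (trace A).re + (trace B).re

/-- The squared modulus of the overlaps between the eigenvectors of `A` and those of `B`. -/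
def overlap (hA : A.IsHermitian) (hB : B.IsHermitian) (i j : ι) : ℝ :=
  Complex.normSq (eigCoord hA hB 1 i j)

lemma re_trace_cfc_cfc (hA : A.IsHermitian) (hB : B.IsHermitian) (f g : ℝ → ℝ) :
    (trace (cfc f A * cfc g B)).re = ∑ i, ∑ j, overlap hA hB i j *
      (f (hA.eigenvalues i) * g (hB.eigenvalues j)) := by
  have h := re_trace_cfc_mul_cfc hA hB f g 1
  rwa [conjTranspose_one, Matrix.one_mul, Matrix.mul_one] at h

lemma mul_cfc_self (hA : A.IsHermitian) (f : ℝ → ℝ) :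
    A * cfc f A = cfc (fun x => x * f x) A := by
  rw [cfc_mul (fun x => x) f A (by fun_prop) (A.finite_real_spectrum.continuousOn f),
    cfc_id_fun hA]

lemma normSq_eigCoord_sub (hA : A.IsHermitian) (hB : B.IsHermitian) (i j : ι) :
    Complex.normSq (eigCoord hA hB (A - B) i j) =
      overlap hA hB i j * (hA.eigenvalues i - hB.eigenvalues j) ^ 2 := by
  have h : eigCoord hA hB (A - B) i j =
      ((hA.eigenvalues i - hB.eigenvalues j : ℝ) : ℂ) * eigCoord hA hB 1 i j := by
    have hU := Unitary.coe_star_mul_self hA.eigenvectorUnitary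
    have hV := Unitary.coe_star_mul_self hB.eigenvectorUnitary
    rw [star_eq_conjTranspose] at hU hV
    have h1 : eigCoord hA hB A = diagonal (fun i => (hA.eigenvalues i : ℂ)) * eigCoord hA hB 1 := by
      have hA' := cfc_eq_mul_diagonal_mul hA (fun x => x)
      rw [cfc_id_fun hA] at hA'
      have := congrArg (fun M => (hA.eigenvectorUnitary : Matrix ι ι ℂ)ᴴ * M *
        (hB.eigenvectorUnitary : Matrix ι ι ℂ)) hA'
      refine this.trans ?_
      simp only [eigCoord, Matrix.mul_one, ← Matrix.mul_assoc, hU, Matrix.one_mul]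
    have h2 : eigCoord hA hB B = eigCoord hA hB 1 * diagonal (fun i => (hB.eigenvalues i : ℂ)) := by
      have hB' := cfc_eq_mul_diagonal_mul hB (fun x => x)
      rw [cfc_id_fun hB] at hB'
      have := congrArg (fun M => (hA.eigenvectorUnitary : Matrix ι ι ℂ)ᴴ * M *
        (hB.eigenvectorUnitary : Matrix ι ι ℂ)) hB'
      refine this.trans ?_
      simp only [eigCoord, Matrix.mul_one, Matrix.mul_assoc, hV]
    have h3 : eigCoord hA hB (A - B) = eigCoord hA hB A - eigCoord hA hB B := by
      simp only [eigCoord, Matrix.mul_sub, Matrix.sub_mul]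
    rw [h3, Matrix.sub_apply, h1, h2, diagonal_mul, mul_diagonal]
    push_cast
    ring
  rw [h, map_mul, Complex.normSq_ofReal, overlap]
  ring

lemma dualForm_sub (hA : A.IsHermitian) (hB : B.IsHermitian) (v : ℝ) :
    dualForm hA hB (A - B) v = ∑ i, ∑ j, overlap hA hB i j *
      ((hA.eigenvalues i - hB.eigenvalues j) ^ 2 *
        (v * hA.eigenvalues i + (1 - v) * hB.eigenvalues j)⁻¹) := by
  simp only [dualForm, normSq_eigCoord_sub, mul_assoc]

theorem relEnt_eq_integral (hA : A.PosDef) (hB : B.PosDef) :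
    relEnt A B = ∫ v in (0 : ℝ)..1, (1 - v) * dualForm hA.1 hB.1 (A - B) v := by
  have hR : ∫ v in (0 : ℝ)..1, (1 - v) * dualForm hA.1 hB.1 (A - B) v =
      ∑ i, ∑ j, overlap hA.1 hB.1 i j * (hA.1.eigenvalues i *
        (Real.log (hA.1.eigenvalues i) - Real.log (hB.1.eigenvalues j)) -
          hA.1.eigenvalues i + hB.1.eigenvalues j) := by
    have hc : ∀ i j, IntervalIntegrable (fun v => overlap hA.1 hB.1 i j * ((1 - v) *
        ((hA.1.eigenvalues i - hB.1.eigenvalues j) ^ 2 *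
          (v * hA.1.eigenvalues i + (1 - v) * hB.1.eigenvalues j)⁻¹))) volume 0 1 := fun i j => by
      apply ContinuousOn.intervalIntegrable
      rw [Set.uIcc_of_le zero_le_one]
      exact continuousOn_const.mul ((by fun_prop : ContinuousOn (fun v : ℝ => 1 - v) _).mul
        (continuousOn_const.mul (continuousOn_inv_mix (hA.eigenvalues_pos i)
          (hB.eigenvalues_pos j))))
    simp only [dualForm_sub, Finset.mul_sum, mul_left_comm (1 - _ : ℝ) (overlap _ _ _ _)]
    rw [integral_finsetSum fun i _ => by
      simpa only [Finset.sum_fn] using IntervalIntegrable.sum Finset.univ fun j _ => hc i j]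
    refine Finset.sum_congr rfl fun i _ => ?_
    rw [integral_finsetSum fun j _ => hc i j]
    refine Finset.sum_congr rfl fun j _ => ?_
    rw [intervalIntegral.integral_const_mul, integral_one_sub_mul_sq_mul_inv_mix
      (hA.eigenvalues_pos i) (hB.eigenvalues_pos j)]
  have e1 := re_trace_cfc_cfc hA.1 hB.1 (fun x => x * Real.log x) (fun _ => 1)
  have e2 := re_trace_cfc_cfc hA.1 hB.1 (fun x => x) Real.log
  have e3 := re_trace_cfc_cfc hA.1 hB.1 (fun x => x) (fun _ => 1)
  have e4 := re_trace_cfc_cfc hA.1 hB.1 (fun _ => 1) (fun x => x)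
  rw [cfc_one_fun hB.1, Matrix.mul_one] at e1 e3
  rw [cfc_one_fun hA.1, Matrix.one_mul] at e4
  rw [cfc_id_fun hA.1] at e2 e3
  rw [cfc_id_fun hB.1] at e4
  rw [hR, relEnt, Matrix.mul_sub, mul_cfc_self hA.1, trace_sub, Complex.sub_re, e1, e2, e3, e4]
  simp only [← Finset.sum_sub_distrib, ← Finset.sum_add_distrib]
  refine Finset.sum_congr rfl fun i _ => Finset.sum_congr rfl fun j _ => ?_
  ring

/-- The integrated dual form; on the diagonal `A = B` this is the second derivative of
`Tr A log A` in direction `X`. -/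
def curvature (hA : A.IsHermitian) (hB : B.IsHermitian) (X : Matrix ι ι ℂ) : ℝ :=
  ∫ v in (0 : ℝ)..1, dualForm hA hB X v

lemma intervalIntegrable_dualForm (hA : A.PosDef) (hB : B.PosDef) (X : Matrix ι ι ℂ) :
    IntervalIntegrable (dualForm hA.1 hB.1 X) volume 0 1 := by
  apply ContinuousOn.intervalIntegrable
  rw [Set.uIcc_of_le zero_le_one]
  exact continuousOn_dualForm hA hB X

lemma intervalIntegrable_one_sub_mul_dualForm (hA : A.PosDef) (hB : B.PosDef)
    (X : Matrix ι ι ℂ) :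
    IntervalIntegrable (fun v => (1 - v) * dualForm hA.1 hB.1 X v) volume 0 1 := by
  apply ContinuousOn.intervalIntegrable
  rw [Set.uIcc_of_le zero_le_one]
  exact (by fun_prop : ContinuousOn (fun v : ℝ => 1 - v) _).mul (continuousOn_dualForm hA hB X)

theorem trace_sub_mul_log_sub_log (hA : A.PosDef) (hB : B.PosDef) :
    (trace ((A - B) * (cfc Real.log A - cfc Real.log B))).re = curvature hA.1 hB.1 (A - B) := by
  have hR : curvature hA.1 hB.1 (A - B) =
      ∑ i, ∑ j, overlap hA.1 hB.1 i j * ((hA.1.eigenvalues i - hB.1.eigenvalues j) *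
        (Real.log (hA.1.eigenvalues i) - Real.log (hB.1.eigenvalues j))) := by
    have hc : ∀ i j, IntervalIntegrable (fun v => overlap hA.1 hB.1 i j *
        ((hA.1.eigenvalues i - hB.1.eigenvalues j) ^ 2 *
          (v * hA.1.eigenvalues i + (1 - v) * hB.1.eigenvalues j)⁻¹)) volume 0 1 := fun i j => by
      apply ContinuousOn.intervalIntegrable
      rw [Set.uIcc_of_le zero_le_one]
      exact continuousOn_const.mul (continuousOn_const.mul
        (continuousOn_inv_mix (hA.eigenvalues_pos i) (hB.eigenvalues_pos j)))
    simp only [curvature, dualForm_sub]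
    rw [integral_finsetSum fun i _ => by
      simpa only [Finset.sum_fn] using IntervalIntegrable.sum Finset.univ fun j _ => hc i j]
    refine Finset.sum_congr rfl fun i _ => ?_
    rw [integral_finsetSum fun j _ => hc i j]
    refine Finset.sum_congr rfl fun j _ => ?_
    rw [intervalIntegral.integral_const_mul, integral_sq_mul_inv_mix
      (hA.eigenvalues_pos i) (hB.eigenvalues_pos j)]
  have e1 := re_trace_cfc_cfc hA.1 hB.1 (fun x => x * Real.log x) (fun _ => 1)
  have e2 := re_trace_cfc_cfc hA.1 hB.1 (fun x => x) Real.log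
  have e3 := re_trace_cfc_cfc hA.1 hB.1 Real.log (fun x => x)
  have e4 := re_trace_cfc_cfc hA.1 hB.1 (fun _ => 1) (fun x => x * Real.log x)
  rw [cfc_one_fun hB.1, Matrix.mul_one] at e1
  rw [cfc_one_fun hA.1, Matrix.one_mul] at e4
  rw [cfc_id_fun hA.1] at e2
  rw [cfc_id_fun hB.1, trace_mul_comm] at e3
  rw [hR, Matrix.sub_mul, Matrix.mul_sub, Matrix.mul_sub, mul_cfc_self hA.1, mul_cfc_self hB.1,
    trace_sub, trace_sub, trace_sub, Complex.sub_re, Complex.sub_re, Complex.sub_re, e1, e2, e3, e4]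
  simp only [← Finset.sum_sub_distrib]
  refine Finset.sum_congr rfl fun i _ => Finset.sum_congr rfl fun j _ => ?_
  ring

theorem relEnt_nonneg (hA : A.PosDef) (hB : B.PosDef) : 0 ≤ relEnt A B := by
  rw [relEnt_eq_integral hA hB]
  exact integral_nonneg zero_le_one fun v hv =>
    mul_nonneg (sub_nonneg.2 hv.2) (dualForm_nonneg hA hB hv _)

lemma curvature_nonneg (hA : A.PosDef) (hB : B.PosDef) (X : Matrix ι ι ℂ) :
    0 ≤ curvature hA.1 hB.1 X :=
  integral_nonneg zero_le_one fun _ hv => dualForm_nonneg hA hB hv _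

lemma curvature_smul (hA : A.IsHermitian) (hB : B.IsHermitian) (X : Matrix ι ι ℂ) (h : ℝ) :
    curvature hA hB ((h : ℂ) • X) = h ^ 2 * curvature hA hB X := by
  rw [curvature, curvature, ← intervalIntegral.integral_const_mul]
  congr 1
  funext v
  have : eigCoord hA hB ((h : ℂ) • X) = (h : ℂ) • eigCoord hA hB X := by
    simp only [eigCoord, Matrix.mul_smul, Matrix.smul_mul]
  simp only [dualForm, this, Matrix.smul_apply, smul_eq_mul, map_mul, Complex.normSq_ofReal,
    Finset.mul_sum]
  refine Finset.sum_congr rfl fun i _ => Finset.sum_congr rfl fun j _ => ?_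
  ring

/-- The curvature is antitone in its base points. -/
lemma curvature_le_of_posSemidef {A' B' : Matrix ι ι ℂ} (hA : A.PosDef) (hB : B.PosDef)
    (hA' : A'.PosDef) (hB' : B'.PosDef) (X : Matrix ι ι ℂ) {κ : ℝ} (hκ : 0 < κ)
    (h1 : ((κ : ℂ) • A - A').PosSemidef) (h2 : ((κ : ℂ) • B - B').PosSemidef) :
    curvature hA.1 hB.1 X ≤ κ * curvature hA'.1 hB'.1 X := by
  rw [curvature, curvature, ← intervalIntegral.integral_const_mul]
  exact integral_mono_on zero_le_one (intervalIntegrable_dualForm hA hB X)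
    ((intervalIntegrable_dualForm hA' hB' X).const_mul κ) fun v hv =>
      dualForm_le_of_mixForm_le hA hB hA' hB' hv X hκ (mixForm_le_of_posSemidef h1 h2 hv)

end RelativeEntropy

section MixedUnitary

variable {ι σ : Type*} [Fintype ι] [DecidableEq ι] [Fintype σ] {A B : Matrix ι ι ℂ}

/-- The map `M ↦ ∑ s, w s • P s * M * (P s)ᴴ`. -/
def mixConj (w : σ → ℝ) (P : σ → Matrix ι ι ℂ) : Matrix ι ι ℂ →ₗ[ℂ] Matrix ι ι ℂ :=
  ∑ s, (w s : ℂ) • (LinearMap.mulLeft ℂ (P s) ∘ₗ LinearMap.mulRight ℂ (P s)ᴴ)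

lemma mixConj_apply (w : σ → ℝ) (P : σ → Matrix ι ι ℂ) (M : Matrix ι ι ℂ) :
    mixConj w P M = ∑ s, (w s : ℂ) • (P s * M * (P s)ᴴ) := by
  simp [mixConj, LinearMap.sum_apply, Matrix.mul_assoc]

lemma mixConj_posDef {w : σ → ℝ} {P : σ → Matrix ι ι ℂ} (hw : ∀ s, 0 ≤ w s)
    (hw1 : ∑ s, w s = 1) (hP : ∀ s, P s ∈ unitaryGroup ι ℂ) (hA : A.PosDef) :
    (mixConj w P A).PosDef := by
  classical
  rw [mixConj_apply]
  obtain ⟨s, hs⟩ : ∃ s, 0 < w s := by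
    by_contra! h
    have := Finset.sum_nonpos fun s (_ : s ∈ Finset.univ) => h s
    linarith
  rw [← Finset.add_sum_erase _ _ (Finset.mem_univ s)]
  refine PosDef.add_posSemidef ?_ (posSemidef_sum _ fun t _ => ?_)
  · refine PosDef.smul ?_ (Complex.zero_lt_real.2 hs)
    exact ((Matrix.IsUnit.posDef_star_right_conjugate_iff
      (Unitary.toUnits ⟨P s, hP s⟩).isUnit).2 hA)
  · exact (hA.posSemidef.mul_mul_conjTranspose_same (P t)).smul (Complex.zero_le_real.2 (hw t))

lemma trace_mixConj {w : σ → ℝ} {P : σ → Matrix ι ι ℂ}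
    (hw1 : ∑ s, w s = 1) (hP : ∀ s, P s ∈ unitaryGroup ι ℂ) (A : Matrix ι ι ℂ) :
    trace (mixConj w P A) = trace A := by
  have h : ∀ s, trace (P s * A * (P s)ᴴ) = trace A := fun s => by
    rw [trace_mul_comm, ← Matrix.mul_assoc, ← star_eq_conjTranspose,
      mem_unitaryGroup_iff'.1 (hP s), Matrix.one_mul]
  rw [mixConj_apply, trace_sum]
  simp only [trace_smul, h, smul_eq_mul]
  rw [← Finset.sum_mul, ← Complex.ofReal_sum, hw1, Complex.ofReal_one, one_mul]

lemma dualForm_mixConj_le {w : σ → ℝ} {P : σ → Matrix ι ι ℂ} (hw : ∀ s, 0 ≤ w s)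
    (hw1 : ∑ s, w s = 1) (hP : ∀ s, P s ∈ unitaryGroup ι ℂ) (hA : A.PosDef) (hB : B.PosDef)
    (X : Matrix ι ι ℂ) {v : ℝ} (hv : v ∈ Set.Icc (0 : ℝ) 1) :
    dualForm (mixConj_posDef hw hw1 hP hA).1 (mixConj_posDef hw hw1 hP hB).1
      (mixConj w P X) v ≤ dualForm hA.1 hB.1 X v := by
  obtain ⟨Y, hY⟩ := exists_dualForm_eq (mixConj_posDef hw hw1 hP hA)
    (mixConj_posDef hw hw1 hP hB) hv (mixConj w P X)
  have hPP : ∀ s, P s * (P s)ᴴ = 1 := fun s => mem_unitaryGroup_iff.1 (hP s)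
  have hPP' : ∀ s (M : Matrix ι ι ℂ), P s * ((P s)ᴴ * M) = M := fun s M => by
    rw [← Matrix.mul_assoc, hPP, Matrix.one_mul]
  have e1 : (trace (Yᴴ * mixConj w P X)).re =
      ∑ s, w s * (trace (((P s)ᴴ * Y * P s)ᴴ * X)).re := by
    rw [mixConj_apply, Matrix.mul_sum, trace_sum, Complex.re_sum]
    refine Finset.sum_congr rfl fun s _ => ?_
    rw [Matrix.mul_smul, trace_smul, smul_eq_mul, Complex.re_ofReal_mul]
    simp only [conjTranspose_mul, conjTranspose_conjTranspose, ← Matrix.mul_assoc]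
    rw [trace_mul_comm]
    simp only [← Matrix.mul_assoc]
  have e2 : (trace (Yᴴ * mixConj w P A * Y)).re =
      ∑ s, w s * (trace (((P s)ᴴ * Y * P s)ᴴ * A * ((P s)ᴴ * Y * P s))).re := by
    rw [mixConj_apply, Matrix.mul_sum, Matrix.sum_mul, trace_sum, Complex.re_sum]
    refine Finset.sum_congr rfl fun s _ => ?_
    rw [Matrix.mul_smul, Matrix.smul_mul, trace_smul, smul_eq_mul, Complex.re_ofReal_mul]
    simp only [conjTranspose_mul, conjTranspose_conjTranspose, Matrix.mul_assoc]
    rw [trace_mul_comm ((P s)ᴴ)]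
    simp only [Matrix.mul_assoc, hPP, Matrix.mul_one]
  have e3 : (trace (Yᴴ * Y * mixConj w P B)).re =
      ∑ s, w s * (trace (((P s)ᴴ * Y * P s)ᴴ * ((P s)ᴴ * Y * P s) * B)).re := by
    rw [mixConj_apply, Matrix.mul_sum, trace_sum, Complex.re_sum]
    refine Finset.sum_congr rfl fun s _ => ?_
    rw [Matrix.mul_smul, trace_smul, smul_eq_mul, Complex.re_ofReal_mul]
    simp only [conjTranspose_mul, conjTranspose_conjTranspose, Matrix.mul_assoc, hPP']
    rw [trace_mul_comm ((P s)ᴴ)]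
    simp only [Matrix.mul_assoc]
  rw [hY, mixForm, e1, e2, e3]
  calc _ = ∑ s, w s * (2 * (trace (((P s)ᴴ * Y * P s)ᴴ * X)).re -
        mixForm A B v ((P s)ᴴ * Y * P s)) := by
        simp only [mixForm, Finset.mul_sum, ← Finset.sum_sub_distrib, ← Finset.sum_add_distrib]
        refine Finset.sum_congr rfl fun s _ => ?_
        ring
    _ ≤ ∑ s, w s * dualForm hA.1 hB.1 X v := Finset.sum_le_sum fun s _ =>
        mul_le_mul_of_nonneg_left (two_mul_trace_sub_mixForm_le hA hB hv _ _) (hw s)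
    _ = _ := by rw [← Finset.sum_mul, hw1, one_mul]

/-- Data processing for mixtures of unitary conjugations. -/
theorem relEnt_mixConj_le {w : σ → ℝ} {P : σ → Matrix ι ι ℂ} (hw : ∀ s, 0 ≤ w s)
    (hw1 : ∑ s, w s = 1) (hP : ∀ s, P s ∈ unitaryGroup ι ℂ) (hA : A.PosDef) (hB : B.PosDef) :
    relEnt (mixConj w P A) (mixConj w P B) ≤ relEnt A B := by
  rw [relEnt_eq_integral hA hB, relEnt_eq_integral (mixConj_posDef hw hw1 hP hA)
    (mixConj_posDef hw hw1 hP hB), ← map_sub]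
  exact integral_mono_on zero_le_one
    (intervalIntegrable_one_sub_mul_dualForm (mixConj_posDef hw hw1 hP hA)
      (mixConj_posDef hw hw1 hP hB) _)
    (intervalIntegrable_one_sub_mul_dualForm hA hB _) fun v hv =>
      mul_le_mul_of_nonneg_left (dualForm_mixConj_le hw hw1 hP hA hB _ hv) (sub_nonneg.2 hv.2)

end MixedUnitary

section RealInequality

open Set

lemma le_of_hasDerivWithinAt_nonneg {f f' : ℝ → ℝ} {a b : ℝ} (hab : a ≤ b)
    (hf : ∀ u ∈ Icc a b, HasDerivWithinAt f (f' u) (Icc a b) u)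
    (h0 : ∀ u ∈ Icc a b, 0 ≤ f' u) : f a ≤ f b := by
  refine monotoneOn_of_hasDerivWithinAt_nonneg (f' := f') (convex_Icc a b)
    (fun u hu => (hf u hu).continuousWithinAt) (fun u hu => ?_) (fun u hu => ?_)
    (left_mem_Icc.2 hab) (right_mem_Icc.2 hab) hab
  · exact (hf u (interior_subset hu)).mono interior_subset
  · exact h0 u (interior_subset hu)

/-- `e`, `m`, `K` are a function on `[-1/3, 1]` and its first two derivatives. If `e` satisfies
the curvature comparison and the data processing hypotheses below, then its increment from `0` to
`-1/3` is at most `1/e` times its increment from `0` to `1`. -/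
lemma sub_le_exp_neg_one_mul {e m K : ℝ → ℝ}
    (he : ∀ u ∈ Icc (-(1 / 3) : ℝ) 1, HasDerivWithinAt e (m u) (Icc (-(1 / 3)) 1) u)
    (hm : ∀ u ∈ Icc (-(1 / 3) : ℝ) 1, HasDerivWithinAt m (K u) (Icc (-(1 / 3)) 1) u)
    (hm0 : m 0 = 0) (hK : 0 ≤ K 0)
    (hpos : ∀ u ∈ Icc (0 : ℝ) 1, K 0 ≤ (1 + 3 * u) * K u)
    (hneg : ∀ u ∈ Icc (-(1 / 3) : ℝ) 0, (1 + 3 * u) * K u ≤ K 0)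
    (hT : e (-(1 / 3)) - e (-(2 / 9)) + (1 / 9) * m (-(2 / 9)) ≤
      e 1 - e (2 / 3) - (1 / 3) * m (2 / 3)) :
    e (-(1 / 3)) - e 0 ≤ Real.exp (-1) * (e 1 - e 0) := by
  have hlow : ∀ a b : ℝ, -(1 / 3) ≤ a → a ≤ b → b ≤ 0 →
      e a - (a + 1 / 3) * m a + K 0 / 3 * a ≤ e b - (b + 1 / 3) * m b + K 0 / 3 * b := by
    intro a b ha hab hb
    have hsub : Icc a b ⊆ Icc (-(1 / 3)) 1 := Icc_subset_Icc ha (by linarith)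
    refine le_of_hasDerivWithinAt_nonneg (f := fun u => e u - (u + 1 / 3) * m u + K 0 / 3 * u)
      (f' := fun u => K 0 / 3 - (u + 1 / 3) * K u) hab (fun u hu => ?_) (fun u hu => ?_)
    · have h1 := (he u (hsub hu)).mono hsub
      have h2 := (hm u (hsub hu)).mono hsub
      have h3 := ((hasDerivWithinAt_id u (Icc a b)).add_const (1 / 3 : ℝ)).mul h2
      have h4 := (hasDerivWithinAt_id u (Icc a b)).const_mul (K 0 / 3)
      refine ((h1.sub h3).add h4).congr_deriv ?_
      simp only [id]
      ring
    · have := hneg u ⟨ha.trans hu.1, hu.2.trans hb⟩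
      linarith
  have hup : e 0 + (1 - 0) * m 0 - K 0 * (-0 / 3 + 4 / 9 * Real.log (1 + 3 * 0)) ≤
      e (2 / 3) + (1 - 2 / 3) * m (2 / 3) -
        K 0 * (-(2 / 3) / 3 + 4 / 9 * Real.log (1 + 3 * (2 / 3))) := by
    have hsub : Icc (0 : ℝ) (2 / 3) ⊆ Icc (-(1 / 3)) 1 :=
      Icc_subset_Icc (by norm_num) (by norm_num)
    refine le_of_hasDerivWithinAt_nonneg
      (f := fun u => e u + (1 - u) * m u - K 0 * (-u / 3 + 4 / 9 * Real.log (1 + 3 * u)))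
      (f' := fun u => (1 - u) * K u - K 0 * ((1 - u) / (1 + 3 * u))) (by norm_num)
      (fun u hu => ?_) (fun u hu => ?_)
    · have hu0 : 1 + 3 * u ≠ 0 := by have := hu.1; positivity
      have h1 := (he u (hsub hu)).mono hsub
      have h2 := (hm u (hsub hu)).mono hsub
      have h3 := ((hasDerivWithinAt_id u (Icc 0 (2 / 3))).const_sub (1 : ℝ)).mul h2
      have h4 := (((hasDerivWithinAt_id u (Icc 0 (2 / 3))).const_mul (3 : ℝ)).const_add (1 : ℝ)).log
        hu0
      have h5 := (((hasDerivWithinAt_id u (Icc 0 (2 / 3))).neg.div_const 3).add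
        (h4.const_mul (4 / 9))).const_mul (K 0)
      refine ((h1.add h3).sub h5).congr_deriv ?_
      have h6 : (1 - u) / (1 + 3 * u) = -1 / 3 + 4 / 9 * (3 * 1 / (1 + 3 * u)) := by
        linear_combination (-1 / 3) * mul_inv_cancel₀ hu0
      simp only [id]
      rw [h6]
      ring
    · have h1 : 0 < 1 + 3 * u := by have := hu.1; positivity
      have h2 := hpos u ⟨hu.1, hu.2.trans (by norm_num)⟩
      have h3 : 0 ≤ 1 - u := by linarith [hu.2]
      have h4 : K 0 / (1 + 3 * u) ≤ K u := (div_le_iff₀' h1).2 h2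
      have h5 := mul_le_mul_of_nonneg_left h4 h3
      have h6 : K 0 * ((1 - u) / (1 + 3 * u)) = (1 - u) * (K 0 / (1 + 3 * u)) := by ring
      linarith
  have h1 := hlow (-(1 / 3)) (-(2 / 9)) (by norm_num) (by norm_num) (by norm_num)
  have h2 := hlow (-(2 / 9)) 0 (by norm_num) (by norm_num) (by norm_num)
  have h3 : Real.log (1 + 3 * (2 / 3)) = Real.log 3 := by norm_num
  rw [h3] at hup
  norm_num [hm0] at h1 h2 hup
  have hl := Real.log_three_gt_d9
  have hE := Real.exp_one_lt_d9
  have hE1 : Real.exp (-1) * Real.exp 1 = 1 := by rw [← Real.exp_add]; simp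
  have hEpos := Real.exp_pos 1
  have hEi := Real.exp_pos (-1)
  suffices h : Real.exp 1 * (e (-(1 / 3)) - e 0) ≤ e 1 - e 0 by
    calc e (-(1 / 3)) - e 0 = Real.exp (-1) * Real.exp 1 * (e (-(1 / 3)) - e 0) := by
          rw [hE1, one_mul]
      _ ≤ _ := by rw [mul_assoc]; exact mul_le_mul_of_nonneg_left h hEi.le
  norm_num at hT ⊢
  set T := e (-1 / 3) - e (-2 / 9) + 1 / 9 * m (-2 / 9) with hTdef
  have hlogK := mul_le_mul_of_nonneg_left hl.le hK
  have hTK : T ≤ K 0 / 27 := by rw [hTdef]; linarith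
  have hx : e (-1 / 3) - e 0 ≤ T + 2 * K 0 / 27 := by rw [hTdef]; linarith
  have hE2 : Real.exp 1 * (e (-1 / 3) - e 0) ≤ Real.exp 1 * (T + 2 * K 0 / 27) :=
    mul_le_mul_of_nonneg_left hx hEpos.le
  have hE3 : (Real.exp 1 - 1) * T ≤ (Real.exp 1 - 1) * (K 0 / 27) :=
    mul_le_mul_of_nonneg_left hTK (by linarith [Real.add_one_le_exp 1])
  have hE4 := mul_le_mul_of_nonneg_right hE.le hK
  linarith

end RealInequality

section Calculus

variable {ι : Type*} [Fintype ι] [DecidableEq ι] {A X : Matrix ι ι ℂ}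

lemma posSemidef_cfc (hA : A.IsHermitian) {f : ℝ → ℝ} (hf : ∀ i, 0 ≤ f (hA.eigenvalues i)) :
    (cfc f A).PosSemidef := by
  rw [cfc_eq_mul_diagonal_mul hA]
  exact (PosSemidef.diagonal fun i => Complex.zero_le_real.2 (hf i)).mul_mul_conjTranspose_same _

lemma exists_posSemidef_sub_smul_one (hA : A.PosDef) :
    ∃ c : ℝ, 0 < c ∧ (A - (c : ℂ) • 1).PosSemidef := by
  have hs : 0 ≤ ∑ i, (hA.1.eigenvalues i)⁻¹ :=
    Finset.sum_nonneg fun i _ => inv_nonneg.2 (hA.eigenvalues_pos i).le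
  refine ⟨(∑ i, (hA.1.eigenvalues i)⁻¹ + 1)⁻¹, by positivity, ?_⟩
  set c := (∑ i, (hA.1.eigenvalues i)⁻¹ + 1)⁻¹ with hc
  have h := posSemidef_cfc hA.1 (f := fun x => x - c * 1) fun i => by
    have h1 : (hA.1.eigenvalues i)⁻¹ ≤ ∑ i, (hA.1.eigenvalues i)⁻¹ :=
      Finset.single_le_sum (f := fun i => (hA.1.eigenvalues i)⁻¹)
        (fun i _ => inv_nonneg.2 (hA.eigenvalues_pos i).le) (Finset.mem_univ i)
    have h2 : c ≤ hA.1.eigenvalues i := by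
      rw [hc]
      exact inv_le_of_inv_le₀ (hA.eigenvalues_pos i) (by linarith)
    linarith
  rw [cfc_sub (fun x => x) (fun _ => c * 1) A (by fun_prop) (by fun_prop),
    cfc_const_mul c (fun _ => (1 : ℝ)) A (by fun_prop), cfc_one_fun hA.1, cfc_id_fun hA.1] at h
  simpa using h

lemma exists_posSemidef_smul_one_add (hX : X.IsHermitian) :
    ∃ c : ℝ, 0 ≤ c ∧ ((c : ℂ) • 1 + X).PosSemidef ∧ ((c : ℂ) • 1 - X).PosSemidef := by
  set c := ∑ i, |hX.eigenvalues i| with hc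
  have h1 : ∀ i, |hX.eigenvalues i| ≤ c := fun i =>
    Finset.single_le_sum (f := fun i => |hX.eigenvalues i|) (fun i _ => abs_nonneg _)
      (Finset.mem_univ i)
  refine ⟨c, Finset.sum_nonneg fun i _ => abs_nonneg _, ?_, ?_⟩
  · have h := posSemidef_cfc hX (f := fun x => c * 1 + x) fun i => by
      linarith [h1 i, neg_abs_le (hX.eigenvalues i)]
    rw [cfc_add X (fun _ => c * 1) (fun x => x) (by fun_prop) (by fun_prop),
      cfc_const_mul c (fun _ => (1 : ℝ)) X (by fun_prop), cfc_one_fun hX, cfc_id_fun hX] at h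
    simpa using h
  · have h := posSemidef_cfc hX (f := fun x => c * 1 - x) fun i => by
      linarith [h1 i, le_abs_self (hX.eigenvalues i)]
    rw [cfc_sub (fun _ => c * 1) (fun x => x) X (by fun_prop) (by fun_prop),
      cfc_const_mul c (fun _ => (1 : ℝ)) X (by fun_prop), cfc_one_fun hX, cfc_id_fun hX] at h
    simpa using h

lemma exists_posSemidef_smul_add (hA : A.PosDef) (hX : X.IsHermitian) :
    ∃ c : ℝ, 0 < c ∧ ((c : ℂ) • A + X).PosSemidef ∧ ((c : ℂ) • A - X).PosSemidef := by
  obtain ⟨a, ha, h1⟩ := exists_posSemidef_sub_smul_one hA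
  obtain ⟨b, hb, h2, h3⟩ := exists_posSemidef_smul_one_add hX
  have hc : 0 ≤ (b + 1) / a := by positivity
  have h4 := h1.smul (Complex.zero_le_real.2 hc)
  have h5 : (1 : Matrix ι ι ℂ).PosSemidef := PosSemidef.one
  have hca : (((b + 1) / a : ℝ) : ℂ) * a = b + 1 := by
    rw [← Complex.ofReal_mul, div_mul_cancel₀ _ ha.ne']; push_cast; rfl
  refine ⟨(b + 1) / a, by positivity, ?_, ?_⟩
  · convert (h4.add h2).add h5 using 1
    rw [smul_sub, smul_smul, hca]
    module
  · convert (h4.add h3).add h5 using 1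
    rw [smul_sub, smul_smul, hca]
    module

end Calculus

section Segment

open Set Filter Topology

variable {ι : Type*} [Fintype ι] [DecidableEq ι] {τ X : Matrix ι ι ℂ} {S : Set ℝ}

/-- `Re Tr A log A`, the negative of the von Neumann entropy in nats. -/
def negEnt (A : Matrix ι ι ℂ) : ℝ := (trace (A * cfc Real.log A)).re

lemma relEnt_eq_negEnt_sub (A B : Matrix ι ι ℂ) (h : trace A = trace B) :
    relEnt A B = negEnt A - (trace (A * cfc Real.log B)).re := by
  rw [relEnt, negEnt, h, Matrix.mul_sub, trace_sub, Complex.sub_re]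
  ring

lemma isHermitian_add_smul (hτ : τ.IsHermitian) (hX : X.IsHermitian) (u : ℝ) :
    (τ + (u : ℂ) • X).IsHermitian := by
  refine hτ.add ?_
  rw [IsHermitian, conjTranspose_smul, hX.eq, Complex.star_def, Complex.conj_ofReal]

lemma add_smul_sub_add_smul (τ X : Matrix ι ι ℂ) (u v : ℝ) :
    τ + (v : ℂ) • X - (τ + (u : ℂ) • X) = ((v - u : ℝ) : ℂ) • X := by
  push_cast
  module

/-- The difference quotient of `u ↦ Re Tr X log (τ + u X)` is a curvature. -/
lemma trace_mul_log_sub_eq (hτ : τ.IsHermitian) (hX : X.IsHermitian)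
    {u v : ℝ} (hu : (τ + (u : ℂ) • X).PosDef) (hv : (τ + (v : ℂ) • X).PosDef) (huv : v ≠ u) :
    (v - u)⁻¹ * ((trace (X * cfc Real.log (τ + (v : ℂ) • X))).re -
      (trace (X * cfc Real.log (τ + (u : ℂ) • X))).re) =
        curvature (isHermitian_add_smul hτ hX v) (isHermitian_add_smul hτ hX u) X := by
  have h := trace_sub_mul_log_sub_log hv hu
  simp only [add_smul_sub_add_smul] at h
  rw [curvature_smul, Matrix.smul_mul, trace_smul, smul_eq_mul, Complex.re_ofReal_mul,
    Matrix.mul_sub, trace_sub, Complex.sub_re] at h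
  have h0 : v - u ≠ 0 := sub_ne_zero.2 huv
  field_simp
  apply mul_left_cancel₀ h0
  rw [h]
  ring

lemma posSemidef_ofReal_smul {A : Matrix ι ι ℂ} {c : ℝ} (hc : 0 ≤ c) (hA : A.PosSemidef) :
    ((c : ℂ) • A).PosSemidef := hA.smul (Complex.zero_le_real.2 hc)

lemma hasDerivWithinAt_trace_mul_log (hτ : τ.IsHermitian) (hX : X.IsHermitian)
    (hS : ∀ u ∈ S, (τ + (u : ℂ) • X).PosDef) {u : ℝ} (hu : u ∈ S) :
    HasDerivWithinAt (fun u : ℝ => (trace (X * cfc Real.log (τ + (u : ℂ) • X))).re)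
      (curvature (isHermitian_add_smul hτ hX u) (isHermitian_add_smul hτ hX u) X) S u := by
  rw [hasDerivWithinAt_iff_tendsto_slope]
  obtain ⟨c, hc, hc1, hc2⟩ := exists_posSemidef_smul_add (hS u hu) hX
  set K := curvature (isHermitian_add_smul hτ hX u) (isHermitian_add_smul hτ hX u) X with hK
  have hmain : ∀ h : ℝ, (((c * |h| : ℝ) : ℂ) • (τ + (u : ℂ) • X) + (h : ℂ) • X).PosSemidef ∧
      (((c * |h| : ℝ) : ℂ) • (τ + (u : ℂ) • X) - (h : ℂ) • X).PosSemidef := by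
    intro h
    have h1 := posSemidef_ofReal_smul (abs_nonneg h) hc1
    have h2 := posSemidef_ofReal_smul (abs_nonneg h) hc2
    rcases abs_choice h with e | e <;> rw [e] at h1 h2 ⊢ <;> push_cast at h1 h2 ⊢
    · constructor
      · convert h1 using 1; module
      · convert h2 using 1; module
    · constructor
      · convert h2 using 1; module
      · convert h1 using 1; module
  have hsmall : ∀ᶠ v in 𝓝[S \ {u}] u, c * |v - u| < 1 := by
    have : Tendsto (fun v : ℝ => c * |v - u|) (𝓝 u) (𝓝 (c * |u - u|)) :=
      Continuous.tendsto (by fun_prop) u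
    rw [sub_self, abs_zero, mul_zero] at this
    exact nhdsWithin_le_nhds (this.eventually (gt_mem_nhds one_pos))
  have hmem : ∀ᶠ v in 𝓝[S \ {u}] u, v ∈ S \ {u} := self_mem_nhdsWithin
  have hlim1 : Tendsto (fun v : ℝ => K / (1 + c * |v - u|)) (𝓝[S \ {u}] u) (𝓝 K) := by
    have : Tendsto (fun v : ℝ => K / (1 + c * |v - u|)) (𝓝 u) (𝓝 (K / (1 + c * |u - u|))) :=
      ContinuousAt.tendsto (ContinuousAt.div (by fun_prop) (by fun_prop) (by simp))
    rw [sub_self, abs_zero, mul_zero, add_zero, div_one] at this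
    exact this.mono_left nhdsWithin_le_nhds
  have hlim2 : Tendsto (fun v : ℝ => (1 - c * |v - u|)⁻¹ * K) (𝓝[S \ {u}] u) (𝓝 K) := by
    have : Tendsto (fun v : ℝ => (1 - c * |v - u|)⁻¹ * K) (𝓝 u)
        (𝓝 ((1 - c * |u - u|)⁻¹ * K)) :=
      ContinuousAt.tendsto (ContinuousAt.mul (ContinuousAt.inv₀ (by fun_prop) (by simp))
        (by fun_prop))
    rw [sub_self, abs_zero, mul_zero, sub_zero, inv_one, one_mul] at this
    exact this.mono_left nhdsWithin_le_nhds
  refine tendsto_of_tendsto_of_tendsto_of_le_of_le' hlim1 hlim2 ?_ ?_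
  · filter_upwards [hmem] with v hv
    rw [slope, vsub_eq_sub, smul_eq_mul,
      trace_mul_log_sub_eq hτ hX (hS u hu) (hS v hv.1) hv.2]
    have hpos : 0 < 1 + c * |v - u| := by positivity
    rw [div_le_iff₀' hpos]
    refine curvature_le_of_posSemidef (hS u hu) (hS u hu) (hS v hv.1) (hS u hu) X hpos ?_ ?_
    · convert (hmain (v - u)).2 using 1
      push_cast
      module
    · convert posSemidef_ofReal_smul (c := c * |v - u|) (by positivity) (hS u hu).posSemidef using 1
      push_cast
      module
  · filter_upwards [hmem, hsmall] with v hv hs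
    rw [slope, vsub_eq_sub, smul_eq_mul,
      trace_mul_log_sub_eq hτ hX (hS u hu) (hS v hv.1) hv.2]
    have hpos : 0 < 1 - c * |v - u| := by linarith
    have hinv : (((1 - c * |v - u|)⁻¹ : ℝ) : ℂ) * ((1 - c * |v - u| : ℝ) : ℂ) = 1 := by
      rw [← Complex.ofReal_mul, inv_mul_cancel₀ hpos.ne', Complex.ofReal_one]
    refine curvature_le_of_posSemidef (hS v hv.1) (hS u hu) (hS u hu) (hS u hu) X
      (inv_pos.2 hpos) ?_ ?_
    · convert posSemidef_ofReal_smul (inv_pos.2 hpos).le (hmain (v - u)).1 using 1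
      have e : ((c * |v - u| : ℝ) : ℂ) • (τ + (u : ℂ) • X) + ((v - u : ℝ) : ℂ) • X =
          (τ + (v : ℂ) • X) - ((1 - c * |v - u| : ℝ) : ℂ) • (τ + (u : ℂ) • X) := by
        push_cast
        module
      rw [e, smul_sub, smul_smul, hinv, one_smul]
    · convert posSemidef_ofReal_smul (c := (1 - c * |v - u|)⁻¹ * (c * |v - u|)) (by positivity)
        (hS u hu).posSemidef using 1
      have e : (1 - c * |v - u|)⁻¹ * (c * |v - u|) = (1 - c * |v - u|)⁻¹ - 1 := by
        field_simp
        ring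
      rw [e]
      push_cast
      module

/-- The Bregman divergence of `negEnt` along a trace-preserving line is the relative entropy. -/
lemma relEnt_add_smul (hX0 : trace X = 0) (u v : ℝ) :
    relEnt (τ + (v : ℂ) • X) (τ + (u : ℂ) • X) =
      negEnt (τ + (v : ℂ) • X) - negEnt (τ + (u : ℂ) • X) -
        (v - u) * (trace (X * cfc Real.log (τ + (u : ℂ) • X))).re := by
  have e : τ + (v : ℂ) • X = (τ + (u : ℂ) • X) + ((v - u : ℝ) : ℂ) • X := by
    push_cast
    module
  rw [relEnt_eq_negEnt_sub _ _ (by simp [hX0]), negEnt.eq_1 (τ + (u : ℂ) • X)]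
  nth_rewrite 2 [e]
  rw [Matrix.add_mul, trace_add, Complex.add_re, Matrix.smul_mul, trace_smul, smul_eq_mul,
    Complex.re_ofReal_mul]
  ring

lemma hasDerivWithinAt_negEnt (hτ : τ.IsHermitian) (hX : X.IsHermitian) (hX0 : trace X = 0)
    (hS : ∀ u ∈ S, (τ + (u : ℂ) • X).PosDef) {u : ℝ} (hu : u ∈ S) :
    HasDerivWithinAt (fun u : ℝ => negEnt (τ + (u : ℂ) • X))
      (trace (X * cfc Real.log (τ + (u : ℂ) • X))).re S u := by
  have hc := (hasDerivWithinAt_trace_mul_log hτ hX hS hu).continuousWithinAt.tendsto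
  rw [hasDerivWithinAt_iff_tendsto_slope, tendsto_iff_norm_sub_tendsto_zero]
  have hc' := (tendsto_iff_norm_sub_tendsto_zero.1 hc).mono_left
    (nhdsWithin_mono u (sdiff_subset (t := {u})))
  refine squeeze_zero' (Eventually.of_forall fun _ => norm_nonneg _) ?_ hc'
  filter_upwards [self_mem_nhdsWithin] with v hv
  have h1 := relEnt_nonneg (hS v hv.1) (hS u hu)
  have h2 := relEnt_nonneg (hS u hu) (hS v hv.1)
  rw [relEnt_add_smul hX0] at h1 h2
  rw [slope, vsub_eq_sub, smul_eq_mul, Real.norm_eq_abs, Real.norm_eq_abs]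
  have h0 : v - u ≠ 0 := sub_ne_zero.2 hv.2
  rw [← mul_le_mul_iff_right₀ (abs_pos.2 h0), ← abs_mul, ← abs_mul, mul_sub,
    mul_inv_cancel_left₀ h0]
  rw [abs_of_nonneg (by linarith), abs_of_nonneg (by linarith)]
  linarith

end Segment

section SingleSite

open Set

variable {ι : Type*} [Fintype ι] [DecidableEq ι] {P : Fin 4 → Matrix ι ι ℂ} {ρ : Matrix ι ι ℂ}

/-- The uniform mixture of the conjugations by `P 0, …, P 3`. -/
def twirl (P : Fin 4 → Matrix ι ι ℂ) : Matrix ι ι ℂ →ₗ[ℂ] Matrix ι ι ℂ :=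
  mixConj (fun _ => 1 / 4) P

/-- Depolarizing noise of strength `p` built from the error operators `P`. -/
def noise (p : ℝ) (P : Fin 4 → Matrix ι ι ℂ) : Matrix ι ι ℂ →ₗ[ℂ] Matrix ι ι ℂ :=
  mixConj (pauliWeight p) P

lemma pauliWeight_nonneg {p : ℝ} (hp0 : 0 ≤ p) (hp1 : p ≤ 1) (s : Fin 4) : 0 ≤ pauliWeight p s := by
  unfold pauliWeight
  split_ifs <;> linarith

lemma sum_pauliWeight (p : ℝ) : ∑ s, pauliWeight p s = 1 := by
  simp [Fin.sum_univ_four, pauliWeight]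
  ring

lemma noise_apply (hP0 : P 0 = 1) (p : ℝ) (M : Matrix ι ι ℂ) :
    noise p P M = ((1 - 4 * p / 3 : ℝ) : ℂ) • M + ((4 * p / 3 : ℝ) : ℂ) • twirl P M := by
  simp only [noise, twirl, mixConj_apply, Fin.sum_univ_four, pauliWeight, hP0, conjTranspose_one,
    Matrix.one_mul, Matrix.mul_one, if_true, if_neg (by decide : (1 : Fin 4) ≠ 0),
    if_neg (by decide : (2 : Fin 4) ≠ 0), if_neg (by decide : (3 : Fin 4) ≠ 0)]
  push_cast
  module

lemma sum_quarter : ∑ _s : Fin 4, (1 / 4 : ℝ) = 1 := by norm_num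

lemma twirl_posDef (hP : ∀ s, P s ∈ unitaryGroup ι ℂ) (hρ : ρ.PosDef) : (twirl P ρ).PosDef :=
  mixConj_posDef (fun _ => by norm_num) sum_quarter hP hρ

lemma noise_posDef {p : ℝ} (hp0 : 0 ≤ p) (hp1 : p ≤ 1) (hP : ∀ s, P s ∈ unitaryGroup ι ℂ)
    (hρ : ρ.PosDef) : (noise p P ρ).PosDef :=
  mixConj_posDef (pauliWeight_nonneg hp0 hp1) (sum_pauliWeight p) hP hρ

lemma trace_twirl (hP : ∀ s, P s ∈ unitaryGroup ι ℂ) (M : Matrix ι ι ℂ) :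
    trace (twirl P M) = trace M :=
  trace_mixConj sum_quarter hP M

lemma twirl_twirl (hE : ∀ s M, P s * twirl P M * (P s)ᴴ = twirl P M) (M : Matrix ι ι ℂ) :
    twirl P (twirl P M) = twirl P M := by
  conv_lhs => rw [twirl, mixConj_apply]
  rw [← twirl]
  simp only [hE, Fin.sum_univ_four]
  push_cast
  module

/-- The logarithm of a twirled matrix does not distinguish a matrix from its twirl. -/
lemma trace_sub_twirl_mul_log (hP : ∀ s, P s ∈ unitaryGroup ι ℂ)
    (hE : ∀ s M, P s * twirl P M * (P s)ᴴ = twirl P M) (ρ : Matrix ι ι ℂ) (f : ℝ → ℝ) :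
    trace ((ρ - twirl P ρ) * cfc f (twirl P ρ)) = 0 := by
  have hPP : ∀ s, (P s)ᴴ * P s = 1 := fun s => mem_unitaryGroup_iff'.1 (hP s)
  have hcomm : ∀ s, Commute (cfc f (twirl P ρ)) (P s) := fun s => by
    refine Commute.cfc_real ?_ f
    have h := congrArg (· * P s) (hE s ρ)
    simp only [Matrix.mul_assoc, hPP, Matrix.mul_one] at h
    exact h.symm
  have h1 : ∀ s, trace (P s * ρ * (P s)ᴴ * cfc f (twirl P ρ)) =
      trace (ρ * cfc f (twirl P ρ)) := fun s => by
    rw [Matrix.mul_assoc, Matrix.mul_assoc, trace_mul_comm, Matrix.mul_assoc, Matrix.mul_assoc,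
      (hcomm s).eq, ← Matrix.mul_assoc (P s)ᴴ, hPP, Matrix.one_mul]
  have h2 : trace (twirl P ρ * cfc f (twirl P ρ)) = trace (ρ * cfc f (twirl P ρ)) := by
    conv_lhs => enter [1, 1]; rw [twirl, mixConj_apply]
    simp only [Fin.sum_univ_four, Matrix.add_mul, Matrix.smul_mul, trace_add, trace_smul, h1,
      smul_eq_mul]
    push_cast
    ring
  rw [Matrix.sub_mul, trace_sub, h2, sub_self]

lemma posDef_add_ofReal_smul {A B : Matrix ι ι ℂ} {a b : ℝ} (ha : 0 ≤ a) (hb : 0 ≤ b)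
    (hab : 0 < a + b) (hA : A.PosDef) (hB : B.PosDef) :
    ((a : ℂ) • A + (b : ℂ) • B).PosDef := by
  rcases ha.eq_or_lt with h | h
  · subst h
    simpa using hB.smul (Complex.zero_lt_real.2 (by linarith : 0 < b))
  · exact (hA.smul (Complex.zero_lt_real.2 h)).add_posSemidef
      (posSemidef_ofReal_smul hb hB.posSemidef)

/-- The segment through `twirl P ρ` and `ρ` stays positive definite down to parameter `-1/3`,
where it meets the depolarizing noise of strength `1`. -/
lemma posDef_segment (hP : ∀ s, P s ∈ unitaryGroup ι ℂ) (hP0 : P 0 = 1) (hρ : ρ.PosDef) {u : ℝ}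
    (hu : u ∈ Icc (-(1 / 3) : ℝ) 1) :
    (twirl P ρ + (u : ℂ) • (ρ - twirl P ρ)).PosDef := by
  rcases le_total 0 u with h | h
  · convert posDef_add_ofReal_smul h (sub_nonneg.2 hu.2) (by linarith) hρ (twirl_posDef hP hρ)
      using 1
    push_cast
    module
  · convert posDef_add_ofReal_smul (a := -3 * u) (b := 1 + 3 * u) (by linarith)
      (by linarith [hu.1]) (by linarith)
      (noise_posDef zero_le_one le_rfl hP hρ) (twirl_posDef hP hρ) using 1
    rw [noise_apply hP0]
    push_cast
    module

lemma noise_segment (hP0 : P 0 = 1) (hE : ∀ s M, P s * twirl P M * (P s)ᴴ = twirl P M)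
    (p u : ℝ) (ρ : Matrix ι ι ℂ) :
    noise p P (twirl P ρ + (u : ℂ) • (ρ - twirl P ρ)) =
      twirl P ρ + (((1 - 4 * p / 3) * u : ℝ) : ℂ) • (ρ - twirl P ρ) := by
  rw [noise_apply hP0, map_add, map_smul, map_sub, twirl_twirl hE]
  push_cast
  module

lemma negEnt_reflect_sub_le (hP : ∀ s, P s ∈ unitaryGroup ι ℂ) (hP0 : P 0 = 1)
    (hE : ∀ s M, P s * twirl P M * (P s)ᴴ = twirl P M) (hρ : ρ.PosDef) :
    negEnt (noise 1 P ρ) - negEnt (twirl P ρ) ≤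
      Real.exp (-1) * (negEnt ρ - negEnt (twirl P ρ)) := by
  set τ := twirl P ρ with hτ
  set X := ρ - τ with hX
  have hpd : ∀ u ∈ Icc (-(1 / 3) : ℝ) 1, (τ + (u : ℂ) • X).PosDef := fun u hu =>
    posDef_segment hP hP0 hρ hu
  have hτH : τ.IsHermitian := (twirl_posDef hP hρ).1
  have hXH : X.IsHermitian := hρ.1.sub hτH
  have hX0 : trace X = 0 := by rw [hX, trace_sub, hτ, trace_twirl hP, sub_self]
  have hω0 : τ + ((0 : ℝ) : ℂ) • X = τ := by simp
  have hω1 : τ + ((1 : ℝ) : ℂ) • X = ρ := by simp [hX]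
  have hnoise : ∀ u : ℝ, noise 1 P (τ + (u : ℂ) • X) = τ + ((-(u / 3) : ℝ) : ℂ) • X := fun u => by
    rw [hX, hτ, noise_segment hP0 hE]
    congr 3
    ring
  have hωm : τ + ((-(1 / 3) : ℝ) : ℂ) • X = noise 1 P ρ := by
    rw [← hnoise, hω1]
  have key := sub_le_exp_neg_one_mul (e := fun u : ℝ => negEnt (τ + (u : ℂ) • X))
    (m := fun u : ℝ => (trace (X * cfc Real.log (τ + (u : ℂ) • X))).re)
    (K := fun u : ℝ => curvature (isHermitian_add_smul hτH hXH u) (isHermitian_add_smul hτH hXH u) X)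
    (fun u hu => hasDerivWithinAt_negEnt hτH hXH hX0 hpd hu)
    (fun u hu => hasDerivWithinAt_trace_mul_log hτH hXH hpd hu) ?_ ?_ ?_ ?_ ?_
  · simp only [hω0, hω1, hωm] at key
    exact key
  · simp only [hω0]
    rw [hX, hτ, trace_sub_twirl_mul_log hP hE, Complex.zero_re]
  · have h0 := hpd 0 (by norm_num)
    exact curvature_nonneg h0 h0 X
  · intro u hu
    have h0 := hpd 0 (by norm_num)
    have h1 := hpd u ⟨by linarith [hu.1], hu.2⟩
    have h2 : (((1 + 3 * u : ℝ) : ℂ) • (τ + ((0 : ℝ) : ℂ) • X) -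
        (τ + (u : ℂ) • X)).PosSemidef := by
      convert posSemidef_ofReal_smul (c := 3 * u) (by linarith [hu.1])
        (hpd (-(1 / 3)) (by norm_num)).posSemidef using 1
      push_cast
      module
    exact curvature_le_of_posSemidef h0 h0 h1 h1 X (by linarith [hu.1]) h2 h2
  · intro u hu
    have h0 := hpd 0 (by norm_num)
    have h1 := hpd u ⟨hu.1, by linarith [hu.2]⟩
    have hK0 := curvature_nonneg h0 h0 X
    rcases hu.1.eq_or_lt with h | h
    · simp only [← h]
      norm_num
      simpa using hK0
    have hpos : 0 < 1 + 3 * u := by linarith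
    have h2 : (((1 + 3 * u)⁻¹ : ℝ) : ℂ) • (τ + (u : ℂ) • X) - (τ + ((0 : ℝ) : ℂ) • X) =
        (((1 + 3 * u)⁻¹ : ℝ) : ℂ) • (((-(3 * u) : ℝ) : ℂ) • (τ + ((-(1 / 3) : ℝ) : ℂ) • X)) := by
      have hinv : (((1 + 3 * u)⁻¹ : ℝ) : ℂ) * ((1 + 3 * u : ℝ) : ℂ) = 1 := by
        rw [← Complex.ofReal_mul, inv_mul_cancel₀ hpos.ne', Complex.ofReal_one]
      have e : ((-(3 * u) : ℝ) : ℂ) • (τ + ((-(1 / 3) : ℝ) : ℂ) • X) =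
          (τ + (u : ℂ) • X) - ((1 + 3 * u : ℝ) : ℂ) • τ := by
        push_cast
        module
      rw [e, smul_sub _ (τ + (u : ℂ) • X), smul_smul, hinv, one_smul, hω0]
    have h3 : ((((1 + 3 * u)⁻¹ : ℝ) : ℂ) • (τ + (u : ℂ) • X) -
        (τ + ((0 : ℝ) : ℂ) • X)).PosSemidef := by
      rw [h2]
      exact posSemidef_ofReal_smul (inv_pos.2 hpos).le (posSemidef_ofReal_smul
        (by linarith [hu.2]) (hpd (-(1 / 3)) (by norm_num)).posSemidef)
    have h4 := curvature_le_of_posSemidef h1 h1 h0 h0 X (inv_pos.2 hpos) h3 h3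
    rwa [le_inv_mul_iff₀ hpos] at h4
  · have h := relEnt_mixConj_le (pauliWeight_nonneg zero_le_one le_rfl) (sum_pauliWeight 1) hP
      (hpd 1 (by norm_num)) (hpd (2 / 3) (by norm_num))
    rw [← noise, hnoise, hnoise, relEnt_add_smul hX0, relEnt_add_smul hX0] at h
    norm_num at h ⊢
    linarith

/-- Depolarizing noise on a single site contracts the entropy deficit by `e ^ (-p)`. -/
theorem negEnt_noise_sub_le (hP : ∀ s, P s ∈ unitaryGroup ι ℂ) (hP0 : P 0 = 1)
    (hE : ∀ s M, P s * twirl P M * (P s)ᴴ = twirl P M) (hρ : ρ.PosDef) {p : ℝ}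
    (hp0 : 0 ≤ p) (hp1 : p ≤ 1) :
    negEnt (noise p P ρ) - negEnt (twirl P ρ) ≤
      Real.exp (-p) * (negEnt ρ - negEnt (twirl P ρ)) := by
  have hrefl := negEnt_reflect_sub_le hP hP0 hE hρ
  set τ := twirl P ρ with hτ
  set X := ρ - τ with hX
  have hpd : ∀ u ∈ Icc (-(1 / 3) : ℝ) 1, (τ + (u : ℂ) • X).PosDef := fun u hu =>
    posDef_segment hP hP0 hρ hu
  have hX0 : trace X = 0 := by rw [hX, trace_sub, hτ, trace_twirl hP, sub_self]
  have hω0 : τ + ((0 : ℝ) : ℂ) • X = τ := by simp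
  have hω1 : τ + ((1 : ℝ) : ℂ) • X = ρ := by simp [hX]
  have hnoise : ∀ q : ℝ, noise q P ρ = τ + ((1 - 4 * q / 3 : ℝ) : ℂ) • X := fun q => by
    have := noise_segment hP0 hE q 1 ρ
    rwa [← hτ, ← hX, hω1, mul_one] at this
  have hnonneg : 0 ≤ negEnt ρ - negEnt τ := by
    have h := relEnt_nonneg hρ (twirl_posDef hP hρ)
    have h2 := trace_sub_twirl_mul_log hP hE ρ Real.log
    rw [relEnt_eq_negEnt_sub _ _ (trace_twirl hP ρ).symm] at h
    rw [Matrix.sub_mul, trace_sub, sub_eq_zero] at h2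
    rw [h2] at h
    exact h
  -- convexity of the negative entropy along the segment
  have hconv : ∀ a ∈ Icc (-(1 / 3) : ℝ) 1, ∀ t ∈ Icc (0 : ℝ) 1,
      negEnt (τ + ((t * a : ℝ) : ℂ) • X) - negEnt τ ≤
        t * (negEnt (τ + (a : ℂ) • X) - negEnt τ) := by
    intro a ha t ht
    have hta : t * a ∈ Icc (-(1 / 3) : ℝ) 1 := by
      constructor <;> nlinarith [ha.1, ha.2, ht.1, ht.2]
    have h1 := relEnt_nonneg (hpd a ha) (hpd _ hta)
    have h2 := relEnt_nonneg (hpd 0 (by norm_num)) (hpd _ hta)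
    rw [relEnt_add_smul hX0] at h1 h2
    rw [hω0] at h2
    have h3 := mul_nonneg ht.1 h1
    have h4 := mul_nonneg (sub_nonneg.2 ht.2) h2
    nlinarith
  rw [hnoise]
  rcases le_total p (3 / 4) with h | h
  · have h1 := hconv 1 (by norm_num) (1 - 4 * p / 3) ⟨by linarith, by linarith⟩
    rw [mul_one, hω1] at h1
    refine h1.trans (mul_le_mul_of_nonneg_right ?_ hnonneg)
    linarith [Real.add_one_le_exp (-p)]
  · have h1 := hconv (-(1 / 3)) (by norm_num) (4 * p - 3) ⟨by linarith, by linarith⟩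
    have h2 : (4 * p - 3) * (-(1 / 3)) = 1 - 4 * p / 3 := by ring
    have h3 : (1 - 4 * 1 / 3 : ℝ) = -(1 / 3) := by norm_num
    rw [hnoise, h3] at hrefl
    rw [h2] at h1
    have h4 : (4 * p - 3) * (negEnt (τ + ((-(1 / 3) : ℝ) : ℂ) • X) - negEnt τ) ≤
        (4 * p - 3) * (Real.exp (-1) * (negEnt ρ - negEnt τ)) :=
      mul_le_mul_of_nonneg_left hrefl (by linarith)
    have h5 : (4 * p - 3) * (Real.exp (-1) * (negEnt ρ - negEnt τ)) ≤
        1 * (Real.exp (-1) * (negEnt ρ - negEnt τ)) :=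
      mul_le_mul_of_nonneg_right (by linarith) (mul_nonneg (Real.exp_pos _).le hnonneg)
    have h6 : Real.exp (-1) * (negEnt ρ - negEnt τ) ≤ Real.exp (-p) * (negEnt ρ - negEnt τ) :=
      mul_le_mul_of_nonneg_right (Real.exp_le_exp.2 (by linarith)) hnonneg
    linarith

end SingleSite

section Sites

variable {ι J : Type*} [Fintype ι] [DecidableEq ι] {Q : J → Fin 4 → Matrix ι ι ℂ}
  {ρ : Matrix ι ι ℂ}

lemma relEnt_twirl {P : Fin 4 → Matrix ι ι ℂ} (hP : ∀ s, P s ∈ unitaryGroup ι ℂ)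
    (hE : ∀ s M, P s * twirl P M * (P s)ᴴ = twirl P M) (ρ : Matrix ι ι ℂ) :
    relEnt ρ (twirl P ρ) = negEnt ρ - negEnt (twirl P ρ) := by
  have h := trace_sub_twirl_mul_log hP hE ρ Real.log
  rw [Matrix.sub_mul, trace_sub, sub_eq_zero] at h
  rw [relEnt_eq_negEnt_sub _ _ (trace_twirl hP ρ).symm, h, negEnt.eq_1 (twirl P ρ)]

lemma mixConj_comm {σ σ' : Type*} [Fintype σ] [Fintype σ'] {P : σ → Matrix ι ι ℂ}
    {R : σ' → Matrix ι ι ℂ} (h : ∀ s t, P s * R t = R t * P s) (w : σ → ℝ) (w' : σ' → ℝ)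
    (M : Matrix ι ι ℂ) :
    mixConj w P (mixConj w' R M) = mixConj w' R (mixConj w P M) := by
  have h' : ∀ s t, P s * (R t * M * (R t)ᴴ) * (P s)ᴴ = R t * (P s * M * (P s)ᴴ) * (R t)ᴴ := by
    intro s t
    calc P s * (R t * M * (R t)ᴴ) * (P s)ᴴ = (P s * R t) * M * (P s * R t)ᴴ := by
          simp only [conjTranspose_mul, Matrix.mul_assoc]
      _ = _ := by rw [h]; simp only [conjTranspose_mul, Matrix.mul_assoc]
  simp only [mixConj_apply, Matrix.mul_sum, Matrix.sum_mul, Matrix.mul_smul, Matrix.smul_mul,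
    Finset.smul_sum, h']
  rw [Finset.sum_comm]
  exact Finset.sum_congr rfl fun t _ => Finset.sum_congr rfl fun s _ => smul_comm _ _ _

/-- Depolarizing noise acting successively on the sites in a list. -/
def noiseSites (p : ℝ) (Q : J → Fin 4 → Matrix ι ι ℂ) (l : List J) (M : Matrix ι ι ℂ) :
    Matrix ι ι ℂ :=
  l.foldr (fun j M => noise p (Q j) M) M

/-- The twirls at the sites in a list. -/
def twirlSites (Q : J → Fin 4 → Matrix ι ι ℂ) (l : List J) (M : Matrix ι ι ℂ) : Matrix ι ι ℂ :=
  l.foldr (fun j M => twirl (Q j) M) M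

lemma noiseSites_cons (p : ℝ) (j : J) (l : List J) (M : Matrix ι ι ℂ) :
    noiseSites p Q (j :: l) M = noise p (Q j) (noiseSites p Q l M) := rfl

lemma twirlSites_cons (j : J) (l : List J) (M : Matrix ι ι ℂ) :
    twirlSites Q (j :: l) M = twirl (Q j) (twirlSites Q l M) := rfl

lemma noiseSites_posDef {p : ℝ} (hp0 : 0 ≤ p) (hp1 : p ≤ 1)
    (hQ : ∀ j s, Q j s ∈ unitaryGroup ι ℂ) (l : List J) (hρ : ρ.PosDef) :
    (noiseSites p Q l ρ).PosDef := by
  induction l with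
  | nil => exact hρ
  | cons j l ih => exact noise_posDef hp0 hp1 (hQ j) ih

lemma relEnt_noiseSites_le {p : ℝ} (hp0 : 0 ≤ p) (hp1 : p ≤ 1)
    (hQ : ∀ j s, Q j s ∈ unitaryGroup ι ℂ) (l : List J) {A B : Matrix ι ι ℂ} (hA : A.PosDef)
    (hB : B.PosDef) : relEnt (noiseSites p Q l A) (noiseSites p Q l B) ≤ relEnt A B := by
  induction l with
  | nil => exact le_rfl
  | cons j l ih =>
    exact (relEnt_mixConj_le (pauliWeight_nonneg hp0 hp1) (sum_pauliWeight p) (hQ j)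
      (noiseSites_posDef hp0 hp1 hQ l hA) (noiseSites_posDef hp0 hp1 hQ l hB)).trans ih

lemma twirl_noiseSites (hcomm : ∀ i j, i ≠ j → ∀ s t, Q i s * Q j t = Q j t * Q i s) (p : ℝ)
    {j : J} {l : List J} (hj : j ∉ l) (M : Matrix ι ι ℂ) :
    twirl (Q j) (noiseSites p Q l M) = noiseSites p Q l (twirl (Q j) M) := by
  induction l with
  | nil => rfl
  | cons i l ih =>
    rw [List.mem_cons, not_or] at hj
    rw [noiseSites_cons, noiseSites_cons, ← ih hj.2]
    exact mixConj_comm (hcomm j i hj.1) _ _ _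

lemma twirl_twirlSites (hcomm : ∀ i j, i ≠ j → ∀ s t, Q i s * Q j t = Q j t * Q i s)
    {j : J} {l : List J} (hj : j ∉ l) (M : Matrix ι ι ℂ) :
    twirl (Q j) (twirlSites Q l M) = twirlSites Q l (twirl (Q j) M) := by
  induction l with
  | nil => rfl
  | cons i l ih =>
    rw [List.mem_cons, not_or] at hj
    rw [twirlSites_cons, twirlSites_cons, ← ih hj.2]
    exact mixConj_comm (hcomm j i hj.1) _ _ _

/-- Independent depolarizing noise contracts the entropy deficit by `e ^ (-p)`, whatever the
number of sites. -/
theorem negEnt_noiseSites_sub_le (hQ : ∀ j s, Q j s ∈ unitaryGroup ι ℂ) (hQ0 : ∀ j, Q j 0 = 1)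
    (hE : ∀ j s M, Q j s * twirl (Q j) M * (Q j s)ᴴ = twirl (Q j) M)
    (hcomm : ∀ i j, i ≠ j → ∀ s t, Q i s * Q j t = Q j t * Q i s)
    {p : ℝ} (hp0 : 0 ≤ p) (hp1 : p ≤ 1) {l : List J} (hl : l.Nodup) (hρ : ρ.PosDef) :
    negEnt (noiseSites p Q l ρ) - negEnt (twirlSites Q l ρ) ≤
      Real.exp (-p) * (negEnt ρ - negEnt (twirlSites Q l ρ)) := by
  induction l generalizing ρ with
  | nil =>
    simp [noiseSites, twirlSites]
  | cons j l ih =>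
    rw [List.nodup_cons] at hl
    have hN := noiseSites_posDef hp0 hp1 hQ l hρ
    have h1 := negEnt_noise_sub_le (hQ j) (hQ0 j) (hE j) hN hp0 hp1
    have h2 := relEnt_noiseSites_le hp0 hp1 hQ l hρ (twirl_posDef (hQ j) hρ)
    rw [← twirl_noiseSites hcomm p hl.1, relEnt_twirl (hQ j) (hE j),
      relEnt_twirl (hQ j) (hE j)] at h2
    have h3 := ih hl.2 (twirl_posDef (hQ j) hρ)
    rw [← twirl_noiseSites hcomm p hl.1, ← twirl_twirlSites hcomm hl.1] at h3
    have h4 := mul_le_mul_of_nonneg_left h2 (Real.exp_pos (-p)).le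
    rw [noiseSites_cons, twirlSites_cons]
    linarith

end Sites

section Qubits

open scoped Kronecker

/-- The tensor product of a family of single-qubit operators. -/
def tensorOp {n : ℕ} (A : Fin n → Matrix (Fin 2) (Fin 2) ℂ) : Matrix (QSpace n) (QSpace n) ℂ :=
  Matrix.of fun x y => ∏ i, A i (x i) (y i)

lemma tensorOp_mul {n : ℕ} (A B : Fin n → Matrix (Fin 2) (Fin 2) ℂ) :
    tensorOp A * tensorOp B = tensorOp fun i => A i * B i := by
  ext x y
  simp only [tensorOp, mul_apply, of_apply, ← Finset.prod_mul_distrib]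
  rw [Finset.prod_univ_sum, Fintype.piFinset_univ]

lemma tensorOp_one (n : ℕ) : tensorOp (fun _ : Fin n => 1) = 1 := by
  ext x y
  simp only [tensorOp, of_apply, one_apply, Finset.prod_ite_zero, Finset.mem_univ, true_imp_iff,
    Finset.prod_const_one, funext_iff]

lemma conjTranspose_tensorOp {n : ℕ} (A : Fin n → Matrix (Fin 2) (Fin 2) ℂ) :
    (tensorOp A)ᴴ = tensorOp fun i => (A i)ᴴ := by
  ext x y
  simp [tensorOp, conjTranspose_apply, star_prod]

variable {R : Type*} [Fintype R] [DecidableEq R] {n : ℕ}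

/-- The single-qubit operator `A` acting on qubit `j`, next to an idle reference system `R`. -/
def siteOp (R : Type*) [DecidableEq R] (j : Fin n) (A : Matrix (Fin 2) (Fin 2) ℂ) :
    Matrix (R × QSpace n) (R × QSpace n) ℂ :=
  (1 : Matrix R R ℂ) ⊗ₖ tensorOp (Function.update (fun _ => 1) j A)

lemma one_kronecker_mul (A B : Matrix (QSpace n) (QSpace n) ℂ) :
    ((1 : Matrix R R ℂ) ⊗ₖ A) * ((1 : Matrix R R ℂ) ⊗ₖ B) = (1 : Matrix R R ℂ) ⊗ₖ (A * B) := by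
  rw [← mul_kronecker_mul, Matrix.one_mul]

lemma siteOp_mul (j : Fin n) (A B : Matrix (Fin 2) (Fin 2) ℂ) :
    siteOp R j A * siteOp R j B = siteOp R j (A * B) := by
  rw [siteOp, siteOp, siteOp, one_kronecker_mul, tensorOp_mul]
  congr 2
  funext i
  rcases eq_or_ne i j with rfl | h
  · simp
  · simp [h]

lemma siteOp_one (j : Fin n) : siteOp R j 1 = 1 := by
  have : Function.update (fun _ : Fin n => (1 : Matrix (Fin 2) (Fin 2) ℂ)) j 1 = fun _ => 1 :=
    Function.update_eq_self j _
  rw [siteOp, this, tensorOp_one, one_kronecker_one]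

lemma conjTranspose_siteOp (j : Fin n) (A : Matrix (Fin 2) (Fin 2) ℂ) :
    (siteOp R j A)ᴴ = siteOp R j Aᴴ := by
  rw [siteOp, siteOp, conjTranspose_kronecker, conjTranspose_one, conjTranspose_tensorOp]
  congr 2
  funext i
  rcases eq_or_ne i j with rfl | h
  · simp
  · simp [h]

lemma siteOp_smul (j : Fin n) (c : ℂ) (A : Matrix (Fin 2) (Fin 2) ℂ) :
    siteOp R j (c • A) = c • siteOp R j A := by
  rw [siteOp, siteOp, ← kronecker_smul]
  congr 1
  ext x y
  simp only [tensorOp, of_apply, Matrix.smul_apply, smul_eq_mul]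
  rw [← Finset.mul_prod_erase _ _ (Finset.mem_univ j),
    ← Finset.mul_prod_erase _ _ (Finset.mem_univ j)]
  simp only [Function.update_self, Matrix.smul_apply, smul_eq_mul, mul_assoc]
  congr 2
  refine Finset.prod_congr rfl fun i hi => ?_
  rw [Function.update_of_ne (Finset.ne_of_mem_erase hi),
    Function.update_of_ne (Finset.ne_of_mem_erase hi)]

lemma siteOp_comm {i j : Fin n} (hij : i ≠ j) (A B : Matrix (Fin 2) (Fin 2) ℂ) :
    siteOp R i A * siteOp R j B = siteOp R j B * siteOp R i A := by
  rw [siteOp, siteOp, one_kronecker_mul, one_kronecker_mul, tensorOp_mul, tensorOp_mul]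
  congr 2
  funext l
  rcases eq_or_ne l i with rfl | h
  · simp [hij]
  · simp [h]

lemma prod_map_siteOp (A : Fin n → Matrix (Fin 2) (Fin 2) ℂ) {l : List (Fin n)} (hl : l.Nodup) :
    (l.map fun i => siteOp R i (A i)).prod =
      (1 : Matrix R R ℂ) ⊗ₖ tensorOp fun i => if i ∈ l then A i else 1 := by
  induction l with
  | nil => simp [tensorOp_one]
  | cons j l ih =>
    rw [List.nodup_cons] at hl
    rw [List.map_cons, List.prod_cons, ih hl.2, siteOp, one_kronecker_mul, tensorOp_mul]
    congr 2
    funext i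
    rcases eq_or_ne i j with rfl | h
    · simp [hl.1]
    · simp [h]

lemma pauli_mul_conjTranspose (s : Fin 4) : pauli s * (pauli s)ᴴ = 1 := by
  fin_cases s <;> ext i j <;> fin_cases i <;> fin_cases j <;>
    simp [pauli, mul_apply, conjTranspose_apply, Fin.sum_univ_two]

lemma exists_pauli_mul_pauli (a b : Fin 4) :
    ∃ c : ℂ, c * star c = 1 ∧ pauli a * pauli b = c • pauli (a ^^^ b) := by
  have h : ∀ c : ℂ, c = 1 ∨ c = Complex.I ∨ c = -Complex.I → c * star c = 1 := by
    rintro c (rfl | rfl | rfl) <;> simp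
  suffices h' : ∃ c : ℂ, (c = 1 ∨ c = Complex.I ∨ c = -Complex.I) ∧
      pauli a * pauli b = c • pauli (a ^^^ b) from h'.imp fun c hc => ⟨h c hc.1, hc.2⟩
  fin_cases a <;> fin_cases b <;>
    first
      | refine ⟨1, Or.inl rfl, ?_⟩; ext i j; fin_cases i <;> fin_cases j <;>
          simp [pauli, mul_apply, Fin.sum_univ_two]; done
      | refine ⟨Complex.I, Or.inr (Or.inl rfl), ?_⟩; ext i j; fin_cases i <;> fin_cases j <;>
          simp [pauli, mul_apply, Fin.sum_univ_two]; done
      | refine ⟨-Complex.I, Or.inr (Or.inr rfl), ?_⟩; ext i j; fin_cases i <;> fin_cases j <;>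
          simp [pauli, mul_apply, Fin.sum_univ_two]; done

/-- The Pauli matrices acting on qubit `j`. -/
def sitePauli (R : Type*) [DecidableEq R] (j : Fin n) (s : Fin 4) :
    Matrix (R × QSpace n) (R × QSpace n) ℂ := siteOp R j (pauli s)

lemma sitePauli_mem_unitaryGroup (j : Fin n) (s : Fin 4) :
    sitePauli R j s ∈ unitaryGroup (R × QSpace n) ℂ := by
  rw [mem_unitaryGroup_iff, star_eq_conjTranspose, sitePauli, conjTranspose_siteOp, siteOp_mul,
    pauli_mul_conjTranspose, siteOp_one]

lemma sitePauli_zero (j : Fin n) : sitePauli R j 0 = 1 := by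
  rw [sitePauli, pauli, if_pos rfl, siteOp_one]

lemma sitePauli_comm {i j : Fin n} (hij : i ≠ j) (s t : Fin 4) :
    sitePauli R i s * sitePauli R j t = sitePauli R j t * sitePauli R i s :=
  siteOp_comm hij _ _

lemma sitePauli_mul_twirl (j : Fin n) (s : Fin 4) (M : Matrix (R × QSpace n) (R × QSpace n) ℂ) :
    sitePauli R j s * twirl (sitePauli R j) M * (sitePauli R j s)ᴴ = twirl (sitePauli R j) M := by
  have h : ∀ t, sitePauli R j s * (sitePauli R j t * M * (sitePauli R j t)ᴴ) *
      (sitePauli R j s)ᴴ = sitePauli R j (s ^^^ t) * M * (sitePauli R j (s ^^^ t))ᴴ := by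
    intro t
    obtain ⟨c, hc, hst⟩ := exists_pauli_mul_pauli s t
    calc _ = (sitePauli R j s * sitePauli R j t) * M * (sitePauli R j s * sitePauli R j t)ᴴ := by
          simp only [conjTranspose_mul, Matrix.mul_assoc]
      _ = (c * star c) • (sitePauli R j (s ^^^ t) * M * (sitePauli R j (s ^^^ t))ᴴ) := by
          rw [sitePauli, sitePauli, siteOp_mul, hst, siteOp_smul, conjTranspose_smul,
            Matrix.smul_mul, Matrix.smul_mul, Matrix.mul_smul, smul_smul]
          rfl
      _ = _ := by rw [hc, one_smul]
  have hinv : Function.Involutive fun t : Fin 4 => s ^^^ t := by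
    have hxor : ∀ s t : Fin 4, s ^^^ (s ^^^ t) = t := by decide
    exact hxor s
  simp only [twirl, mixConj_apply, Matrix.mul_sum, Matrix.sum_mul, Matrix.mul_smul,
    Matrix.smul_mul, h]
  exact Equiv.sum_comp hinv.toPerm fun t =>
    ((1 / 4 : ℝ) : ℂ) • (sitePauli R j t * M * (sitePauli R j t)ᴴ)

lemma noiseSites_finRange {ι : Type*} [Fintype ι] [DecidableEq ι] (p : ℝ) {m : ℕ}
    (Q : Fin m → Fin 4 → Matrix ι ι ℂ) (M : Matrix ι ι ℂ) :
    noiseSites p Q (List.finRange m) M = ∑ s : Fin m → Fin 4,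
      ((∏ i, pauliWeight p (s i) : ℝ) : ℂ) •
        (((List.finRange m).map fun i => Q i (s i)).prod * M *
          ((List.finRange m).map fun i => Q i (s i)).prodᴴ) := by
  induction m with
  | zero => simp [noiseSites]
  | succ m ih =>
    have h : noiseSites p Q ((List.finRange m).map Fin.succ) M =
        noiseSites p (fun i => Q i.succ) (List.finRange m) M := by
      rw [noiseSites, List.foldr_map]
      rfl
    rw [List.finRange_succ, noiseSites_cons, h, ih, noise, mixConj_apply,
      ← (Fin.consEquiv fun _ => Fin 4).sum_comp, Fintype.sum_prod_type]
    refine Finset.sum_congr rfl fun a _ => ?_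
    rw [Matrix.mul_sum, Matrix.sum_mul, Finset.smul_sum]
    refine Finset.sum_congr rfl fun s _ => ?_
    simp only [Fin.consEquiv_apply, Fin.prod_univ_succ, Fin.cons_zero, Fin.cons_succ,
      List.map_cons, List.map_map, Function.comp_def, List.prod_cons, conjTranspose_mul,
      Matrix.mul_smul, Matrix.smul_mul, smul_smul, Matrix.mul_assoc, Complex.ofReal_mul]

lemma idTensor_conj (A : Matrix (QSpace n) (QSpace n) ℂ)
    (M : Matrix (R × QSpace n) (R × QSpace n) ℂ) :
    idTensor (fun X => A * X * Aᴴ) M =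
      ((1 : Matrix R R ℂ) ⊗ₖ A) * M * ((1 : Matrix R R ℂ) ⊗ₖ A)ᴴ := by
  ext ⟨r, x⟩ ⟨r', y⟩
  simp [idTensor, mul_apply, conjTranspose_apply, kroneckerMap_apply, Fintype.sum_prod_type,
    one_apply, ite_mul, mul_ite, apply_ite star]

/-- A layer of depolarizing noise next to an idle reference system acts site by site. -/
lemma idTensor_depolLayer (p : ℝ) (M : Matrix (R × QSpace n) (R × QSpace n) ℂ) :
    idTensor (depolLayer p) M = noiseSites p (sitePauli R) (List.finRange n) M := by
  rw [noiseSites_finRange]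
  simp only [sitePauli]
  have h : ∀ s : Fin n → Fin 4, (1 : Matrix R R ℂ) ⊗ₖ pauliString s =
      ((List.finRange n).map fun i => siteOp R i (pauli (s i))).prod := fun s => by
    rw [prod_map_siteOp (fun i => pauli (s i)) (List.nodup_finRange n)]
    simp only [List.mem_finRange, if_true]
    rfl
  simp only [← h, ← idTensor_conj]
  ext x y
  simp [idTensor, depolLayer, Matrix.sum_apply]

end Qubits

section Layers

open scoped Kronecker

variable {R : Type*} [Fintype R] [DecidableEq R] {n : ℕ}

lemma sum_pauli_mul_star (a a' b b' : Fin 2) :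
    ∑ s, ((pauliWeight (3 / 4) s : ℝ) : ℂ) * (pauli s a a' * star (pauli s b b')) =
      if a = b ∧ a' = b' then 1 / 2 else 0 := by
  fin_cases a <;> fin_cases a' <;> fin_cases b <;> fin_cases b' <;>
    simp [Fin.sum_univ_four, pauliWeight, pauli] <;> norm_num

lemma depolLayer_three_quarters (X : Matrix (QSpace n) (QSpace n) ℂ) :
    depolLayer (3 / 4) X = (trace X / 2 ^ n) • 1 := by
  ext x y
  have h : ∀ a b : QSpace n, ∑ s : Fin n → Fin 4,
      ((∏ i, pauliWeight (3 / 4) (s i) : ℝ) : ℂ) * (pauliString s x a * star (pauliString s y b)) =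
      if x = y ∧ a = b then (1 / 2) ^ n else 0 := by
    intro a b
    simp only [pauliString, of_apply, star_prod, Complex.ofReal_prod, ← Finset.prod_mul_distrib]
    have := Finset.prod_univ_sum (fun _ : Fin n => (Finset.univ : Finset (Fin 4)))
      fun i s => ((pauliWeight (3 / 4) s : ℝ) : ℂ) *
        (pauli s (x i) (a i) * star (pauli s (y i) (b i)))
    rw [Fintype.piFinset_univ] at this
    rw [← this]
    simp only [sum_pauli_mul_star, Finset.prod_ite_zero, Finset.mem_univ, true_imp_iff,
      Finset.prod_const, Finset.card_univ, Fintype.card_fin, forall_and, funext_iff]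
  have h' : depolLayer (3 / 4) X x y = ∑ a, ∑ b, X a b * ∑ s : Fin n → Fin 4,
      ((∏ i, pauliWeight (3 / 4) (s i) : ℝ) : ℂ) *
        (pauliString s x a * star (pauliString s y b)) := by
    simp only [depolLayer, Matrix.sum_apply, Matrix.smul_apply, mul_apply, conjTranspose_apply,
      smul_eq_mul, Finset.mul_sum, Finset.sum_mul]
    rw [Finset.sum_comm, Finset.sum_comm]
    simp only [Finset.sum_comm (s := (Finset.univ : Finset (Fin n → Fin 4)))]
    rw [Finset.sum_comm]
    refine Finset.sum_congr rfl fun a _ => Finset.sum_congr rfl fun b _ =>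
      Finset.sum_congr rfl fun s _ => ?_
    ring
  rw [h']
  simp only [h]
  rcases eq_or_ne x y with rfl | hxy
  · simp [trace, Finset.sum_mul, div_eq_mul_inv]
  · simp [hxy]

lemma pauliString_mem_unitaryGroup (s : Fin n → Fin 4) :
    pauliString s ∈ unitaryGroup (QSpace n) ℂ := by
  have h : pauliString s = tensorOp fun i => pauli (s i) := rfl
  rw [mem_unitaryGroup_iff, star_eq_conjTranspose, h, conjTranspose_tensorOp, tensorOp_mul]
  simp only [pauli_mul_conjTranspose, tensorOp_one]

lemma trace_conj_of_mem_unitaryGroup {ι : Type*} [Fintype ι] [DecidableEq ι] {V : Matrix ι ι ℂ}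
    (hV : V ∈ unitaryGroup ι ℂ) (X : Matrix ι ι ℂ) : trace (V * X * Vᴴ) = trace X := by
  rw [trace_mul_cycle, ← star_eq_conjTranspose, mem_unitaryGroup_iff'.1 hV, Matrix.one_mul]

lemma trace_depolLayer (p : ℝ) (X : Matrix (QSpace n) (QSpace n) ℂ) :
    trace (depolLayer p X) = trace X := by
  have h : ∑ s : Fin n → Fin 4, ∏ i, pauliWeight p (s i) = 1 := by
    have := Finset.prod_univ_sum (fun _ : Fin n => (Finset.univ : Finset (Fin 4)))
      fun _ s => pauliWeight p s
    rw [Fintype.piFinset_univ] at this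
    rw [← this]
    simp only [sum_pauliWeight, Finset.prod_const_one]
  simp only [depolLayer, trace_sum, trace_smul,
    trace_conj_of_mem_unitaryGroup (pauliString_mem_unitaryGroup _), ← Finset.sum_smul]
  rw [← Complex.ofReal_sum, h, Complex.ofReal_one, one_smul]

/-- The marginal of a bipartite operator on the first tensor factor. -/
def blockTrace {A : Type*} [Fintype A] (M : Matrix (R × A) (R × A) ℂ) : Matrix R R ℂ :=
  Matrix.of fun r r' => trace (Matrix.of fun a a' => M (r, a) (r', a'))

lemma blockTrace_idTensor {A B : Type*} [Fintype A] [Fintype B] {E : Matrix A A ℂ → Matrix B B ℂ}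
    (hE : ∀ X, trace (E X) = trace X) (M : Matrix (R × A) (R × A) ℂ) :
    blockTrace (idTensor E M) = blockTrace M := by
  ext r r'
  exact hE (Matrix.of fun a a' => M (r, a) (r', a'))

lemma trace_blockTrace {A : Type*} [Fintype A] (M : Matrix (R × A) (R × A) ℂ) :
    trace (blockTrace M) = trace M := by
  simp [blockTrace, trace, Fintype.sum_prod_type]

lemma twirlSites_eq_noiseSites {ι J : Type*} [Fintype ι] [DecidableEq ι]
    (Q : J → Fin 4 → Matrix ι ι ℂ) (l : List J) (M : Matrix ι ι ℂ) :
    twirlSites Q l M = noiseSites (3 / 4) Q l M := by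
  have h : pauliWeight (3 / 4) = fun _ => 1 / 4 := by
    funext s
    unfold pauliWeight
    split_ifs <;> norm_num
  simp only [twirlSites, noiseSites, twirl, noise, h]

lemma twirlSites_sitePauli {M : Matrix (R × QSpace n) (R × QSpace n) ℂ}
    (hM : blockTrace M = ((Fintype.card R : ℂ))⁻¹ • 1) :
    twirlSites (sitePauli R) (List.finRange n) M =
      (((Fintype.card R * 2 ^ n : ℝ)⁻¹ : ℝ) : ℂ) • 1 := by
  rw [twirlSites_eq_noiseSites, ← idTensor_depolLayer]
  ext ⟨r, x⟩ ⟨r', y⟩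
  have h := congrFun (congrFun hM r) r'
  simp only [blockTrace, of_apply] at h
  simp only [idTensor, of_apply, depolLayer_three_quarters, h, Matrix.smul_apply, one_apply,
    Prod.mk.injEq]
  rcases eq_or_ne r r' with rfl | hr
  · rcases eq_or_ne x y with rfl | hx
    · simp [div_eq_mul_inv, mul_comm]
    · simp [hx]
  · simp [hr]

lemma one_kronecker_mem_unitaryGroup {V : Matrix (QSpace n) (QSpace n) ℂ}
    (hV : V ∈ unitaryGroup (QSpace n) ℂ) :
    (1 : Matrix R R ℂ) ⊗ₖ V ∈ unitaryGroup (R × QSpace n) ℂ := by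
  rw [mem_unitaryGroup_iff, star_eq_conjTranspose, conjTranspose_kronecker, conjTranspose_one,
    one_kronecker_mul, ← star_eq_conjTranspose, mem_unitaryGroup_iff.1 hV, one_kronecker_one]

end Layers

section Entropy

open Set Filter Topology

variable {ι : Type*} [Fintype ι] [DecidableEq ι] {A : Matrix ι ι ℂ}

lemma re_trace_cfc (hA : A.IsHermitian) (f : ℝ → ℝ) :
    (trace (cfc f A)).re = ∑ i, f (hA.eigenvalues i) := by
  rw [cfc_eq_mul_diagonal_mul hA, trace_mul_cycle, ← star_eq_conjTranspose,
    mem_unitaryGroup_iff'.1 hA.eigenvectorUnitary.2, Matrix.one_mul, trace_diagonal,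
    Complex.re_sum]
  simp only [Complex.ofReal_re]

lemma negEnt_eq_sum (hA : A.IsHermitian) :
    negEnt A = ∑ i, hA.eigenvalues i * Real.log (hA.eigenvalues i) := by
  rw [negEnt, mul_cfc_self hA, re_trace_cfc hA]

lemma sum_eigenvalues (hA : A.IsHermitian) : ∑ i, hA.eigenvalues i = (trace A).re := by
  rw [← re_trace_cfc hA fun x => x, cfc_id_fun hA]

lemma vN_eq (hA : A.IsHermitian) : vN A = -negEnt A / Real.log 2 := by
  rw [vN, dif_pos hA, negEnt_eq_sum hA, neg_div, Finset.sum_div]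
  simp only [Real.logb, mul_div_assoc]

lemma negEnt_nonpos (hA : A.PosSemidef) (htr : trace A = 1) : negEnt A ≤ 0 := by
  rw [negEnt_eq_sum hA.1]
  refine Finset.sum_nonpos fun i _ => Real.mul_log_nonpos (hA.eigenvalues_nonneg i) ?_
  calc hA.1.eigenvalues i ≤ ∑ j, hA.1.eigenvalues j :=
        Finset.single_le_sum (fun j _ => hA.eigenvalues_nonneg j) (Finset.mem_univ i)
    _ = 1 := by rw [sum_eigenvalues, htr, Complex.one_re]

lemma neg_mul_log_le {x N : ℝ} (hx : 0 ≤ x) (hN : 0 < N) :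
    -(x * Real.log x) ≤ x * Real.log N + (N⁻¹ - x) := by
  rcases hx.eq_or_lt with rfl | hx
  · simp [hN.le]
  · have h := Real.log_le_sub_one_of_pos (x := (x * N)⁻¹) (by positivity)
    rw [Real.log_inv, Real.log_mul hx.ne' hN.ne'] at h
    have h2 := mul_le_mul_of_nonneg_left h hx.le
    have h3 : x * ((x * N)⁻¹ - 1) = N⁻¹ - x := by field_simp
    linarith

lemma neg_negEnt_le [Nonempty ι] (hA : A.PosSemidef) (htr : trace A = 1) :
    -negEnt A ≤ Real.log (Fintype.card ι) := by
  have hN : (0 : ℝ) < Fintype.card ι := Nat.cast_pos.2 Fintype.card_pos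
  have h1 : ∑ i, hA.1.eigenvalues i = 1 := by rw [sum_eigenvalues, htr, Complex.one_re]
  rw [negEnt_eq_sum hA.1, ← Finset.sum_neg_distrib]
  calc _ ≤ ∑ i, (hA.1.eigenvalues i * Real.log (Fintype.card ι) +
        ((Fintype.card ι : ℝ)⁻¹ - hA.1.eigenvalues i)) :=
        Finset.sum_le_sum fun i _ => neg_mul_log_le (hA.eigenvalues_nonneg i) hN
    _ = _ := by
      rw [Finset.sum_add_distrib, ← Finset.sum_mul, Finset.sum_sub_distrib, h1]
      simp [hN.ne']

lemma cfc_log_smul_one (c : ℝ) :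
    cfc Real.log ((c : ℂ) • (1 : Matrix ι ι ℂ)) = ((Real.log c : ℝ) : ℂ) • 1 := by
  have h : ∀ x : ℝ, (x : ℂ) • (1 : Matrix ι ι ℂ) = algebraMap ℝ (Matrix ι ι ℂ) x := fun x => by
    rw [Algebra.algebraMap_eq_smul_one]
    ext i j
    simp
  rw [h, h, cfc_algebraMap]

lemma relEnt_smul_one {c : ℝ} (h1 : trace A = 1) (hc : c * Fintype.card ι = 1) :
    relEnt A ((c : ℂ) • 1) = negEnt A - Real.log c := by
  rw [relEnt_eq_negEnt_sub, cfc_log_smul_one, Matrix.mul_smul, Matrix.mul_one, trace_smul, h1]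
  · simp
  · rw [h1, trace_smul, trace_one, smul_eq_mul]
    exact_mod_cast hc.symm

lemma negEnt_smul_one {c : ℝ} (hc : c * Fintype.card ι = 1) :
    negEnt ((c : ℂ) • (1 : Matrix ι ι ℂ)) = Real.log c := by
  rw [negEnt, cfc_log_smul_one, Matrix.mul_smul, Matrix.mul_one, trace_smul, trace_smul, trace_one,
    smul_eq_mul, smul_eq_mul, ← Complex.ofReal_natCast, ← Complex.ofReal_mul, hc]
  simp

lemma posDef_smul_one {c : ℝ} (hc : 0 < c) : ((c : ℂ) • (1 : Matrix ι ι ℂ)).PosDef :=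
  PosDef.one.smul (Complex.zero_lt_real.2 hc)

lemma negEnt_conj_le {V : Matrix ι ι ℂ} (hV : V ∈ unitaryGroup ι ℂ) (hA : A.PosDef)
    (h1 : trace A = 1) : negEnt (V * A * Vᴴ) ≤ negEnt A := by
  have hcard : Fintype.card ι ≠ 0 := by
    intro h
    have := Fintype.card_eq_zero_iff.1 h
    simp [trace] at h1
  have hN : (0 : ℝ) < Fintype.card ι := Nat.cast_pos.2 (Nat.pos_of_ne_zero hcard)
  have hc : (Fintype.card ι : ℝ)⁻¹ * Fintype.card ι = 1 := inv_mul_cancel₀ hN.ne'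
  have h := relEnt_mixConj_le (σ := Unit) (w := fun _ => 1) (P := fun _ => V)
    (fun _ => zero_le_one) (by simp) (fun _ => hV) hA (posDef_smul_one (inv_pos.2 hN))
  have e : ∀ X, mixConj (fun _ : Unit => (1 : ℝ)) (fun _ => V) X = V * X * Vᴴ := fun X => by
    simp [mixConj_apply]
  rw [e, e, Matrix.mul_smul, Matrix.smul_mul, Matrix.mul_one, ← star_eq_conjTranspose,
    mem_unitaryGroup_iff.1 hV, relEnt_smul_one h1 hc, relEnt_smul_one _ hc] at h
  · exact (sub_le_sub_iff_right _).1 h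
  · rw [star_eq_conjTranspose, trace_conj_of_mem_unitaryGroup hV, h1]

lemma negEnt_smul_add_smul_one (hA : A.IsHermitian) (a b : ℝ) :
    negEnt ((a : ℂ) • A + (b : ℂ) • 1) =
      ∑ i, (a * hA.eigenvalues i + b) * Real.log (a * hA.eigenvalues i + b) := by
  have h : (a : ℂ) • A + (b : ℂ) • 1 = cfc (fun x : ℝ => a * x + b) A := by
    rw [cfc_add A (fun x => a * x) (fun _ => b), cfc_const_mul a (fun x => x) A,
      cfc_const b A hA.isSelfAdjoint, cfc_id_fun hA, Algebra.algebraMap_eq_smul_one]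
    ext i j
    simp
  rw [negEnt, mul_cfc_self (h ▸ (cfc_predicate (fun x : ℝ => a * x + b) A).isHermitian), h,
    ← cfc_comp' (fun x => x * Real.log x) (fun x => a * x + b) A
      ((A.finite_real_spectrum.image _).continuousOn _), re_trace_cfc hA]

lemma tendsto_negEnt_mix (hA : A.IsHermitian) (c : ℝ) :
    Tendsto (fun ε : ℝ => negEnt (((1 - ε : ℝ) : ℂ) • A + ((ε * c : ℝ) : ℂ) • 1)) (𝓝[>] 0)
      (𝓝 (negEnt A)) := by
  have h : Continuous fun ε : ℝ => ∑ i, ((1 - ε) * hA.eigenvalues i + ε * c) *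
      Real.log ((1 - ε) * hA.eigenvalues i + ε * c) :=
    continuous_finsetSum _ fun i _ => Real.continuous_mul_log.comp (by fun_prop)
  have h0 := h.tendsto 0
  simp only [sub_zero, one_mul, zero_mul, add_zero, ← negEnt_eq_sum hA] at h0
  simp only [negEnt_smul_add_smul_one hA]
  exact h0.mono_left nhdsWithin_le_nhds

end Entropy

section Circuit

open scoped Kronecker

variable {n : ℕ} {p : ℝ} {R : Type*} [Fintype R] [DecidableEq R]

lemma mixConj_one {ι σ : Type*} [Fintype ι] [DecidableEq ι] [Fintype σ] {w : σ → ℝ}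
    {P : σ → Matrix ι ι ℂ} (hw1 : ∑ s, w s = 1) (hP : ∀ s, P s ∈ unitaryGroup ι ℂ) :
    mixConj w P 1 = 1 := by
  have hPP : ∀ s, P s * (P s)ᴴ = 1 := fun s => mem_unitaryGroup_iff.1 (hP s)
  simp only [mixConj_apply, Matrix.mul_one, hPP, ← Finset.sum_smul]
  rw [← Complex.ofReal_sum, hw1, Complex.ofReal_one, one_smul]

lemma mixConj_posSemidef {ι σ : Type*} [Fintype ι] [DecidableEq ι] [Fintype σ] {w : σ → ℝ}
    (hw : ∀ s, 0 ≤ w s) (P : σ → Matrix ι ι ℂ) {A : Matrix ι ι ℂ} (hA : A.PosSemidef) :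
    (mixConj w P A).PosSemidef := by
  rw [mixConj_apply]
  exact posSemidef_sum _ fun s _ =>
    posSemidef_ofReal_smul (hw s) (hA.mul_mul_conjTranspose_same (P s))

lemma noiseSites_posSemidef {ι J : Type*} [Fintype ι] [DecidableEq ι] (hp0 : 0 ≤ p) (hp1 : p ≤ 1)
    (Q : J → Fin 4 → Matrix ι ι ℂ) (l : List J) {A : Matrix ι ι ℂ} (hA : A.PosSemidef) :
    (noiseSites p Q l A).PosSemidef := by
  induction l with
  | nil => exact hA
  | cons j l ih => exact mixConj_posSemidef (pauliWeight_nonneg hp0 hp1) _ ih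

lemma noiseSites_add_smul_one {ι J : Type*} [Fintype ι] [DecidableEq ι]
    {Q : J → Fin 4 → Matrix ι ι ℂ} (hQ : ∀ j s, Q j s ∈ unitaryGroup ι ℂ) (l : List J)
    (A : Matrix ι ι ℂ) (a b : ℂ) :
    noiseSites p Q l (a • A + b • 1) = a • noiseSites p Q l A + b • 1 := by
  induction l with
  | nil => rfl
  | cons j l ih =>
    rw [noiseSites_cons, ih, map_add, map_smul, map_smul, noiseSites_cons, noise,
      mixConj_one (sum_pauliWeight p) (hQ j)]

/-- One noisy layer next to an idle reference system. -/
lemma idTensor_layer (V : Matrix (QSpace n) (QSpace n) ℂ)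
    (M : Matrix (R × QSpace n) (R × QSpace n) ℂ) :
    idTensor (fun σ => depolLayer p (V * σ * Vᴴ)) M =
      noiseSites p (sitePauli R) (List.finRange n)
        (((1 : Matrix R R ℂ) ⊗ₖ V) * M * ((1 : Matrix R R ℂ) ⊗ₖ V)ᴴ) := by
  rw [← idTensor_conj, ← idTensor_depolLayer]
  rfl

/-- The noisy circuit with the given unitary layers, next to an idle reference system. -/
def layers (p : ℝ) (R : Type*) (l : List (Matrix (QSpace n) (QSpace n) ℂ)) :
    Matrix (R × QSpace n) (R × QSpace n) ℂ → Matrix (R × QSpace n) (R × QSpace n) ℂ :=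
  idTensor fun ρ => l.foldl (fun σ V => depolLayer p (V * σ * Vᴴ)) ρ

lemma layers_cons (V : Matrix (QSpace n) (QSpace n) ℂ) (l : List (Matrix (QSpace n) (QSpace n) ℂ))
    (M : Matrix (R × QSpace n) (R × QSpace n) ℂ) :
    layers p R (V :: l) M = layers p R l (noiseSites p (sitePauli R) (List.finRange n)
      (((1 : Matrix R R ℂ) ⊗ₖ V) * M * ((1 : Matrix R R ℂ) ⊗ₖ V)ᴴ)) := by
  rw [← idTensor_layer]
  rfl

lemma layers_posSemidef (hp0 : 0 ≤ p) (hp1 : p ≤ 1)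
    (l : List (Matrix (QSpace n) (QSpace n) ℂ)) {M : Matrix (R × QSpace n) (R × QSpace n) ℂ}
    (hM : M.PosSemidef) : (layers p R l M).PosSemidef := by
  induction l generalizing M with
  | nil => exact hM
  | cons V l ih =>
    rw [layers_cons]
    exact ih (noiseSites_posSemidef hp0 hp1 _ _ (hM.mul_mul_conjTranspose_same _))

lemma layers_add_smul_one {l : List (Matrix (QSpace n) (QSpace n) ℂ)}
    (hl : ∀ V ∈ l, V ∈ unitaryGroup (QSpace n) ℂ) (M : Matrix (R × QSpace n) (R × QSpace n) ℂ)
    (a b : ℂ) : layers p R l (a • M + b • 1) = a • layers p R l M + b • 1 := by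
  induction l generalizing M with
  | nil => rfl
  | cons V l ih =>
    have hV := one_kronecker_mem_unitaryGroup (R := R) (hl V List.mem_cons_self)
    rw [layers_cons, layers_cons, Matrix.mul_add, Matrix.add_mul, Matrix.mul_smul,
      Matrix.smul_mul, Matrix.mul_smul, Matrix.smul_mul, Matrix.mul_one, ← star_eq_conjTranspose,
      mem_unitaryGroup_iff.1 hV, noiseSites_add_smul_one sitePauli_mem_unitaryGroup,
      ih fun W hW => hl W (List.mem_cons_of_mem _ hW)]

lemma blockTrace_layer {V : Matrix (QSpace n) (QSpace n) ℂ} (hV : V ∈ unitaryGroup (QSpace n) ℂ)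
    (M : Matrix (R × QSpace n) (R × QSpace n) ℂ) :
    blockTrace (noiseSites p (sitePauli R) (List.finRange n)
      (((1 : Matrix R R ℂ) ⊗ₖ V) * M * ((1 : Matrix R R ℂ) ⊗ₖ V)ᴴ)) = blockTrace M := by
  rw [← idTensor_layer, blockTrace_idTensor fun X => by
    rw [trace_depolLayer, trace_conj_of_mem_unitaryGroup hV]]

lemma blockTrace_layers {l : List (Matrix (QSpace n) (QSpace n) ℂ)}
    (hl : ∀ V ∈ l, V ∈ unitaryGroup (QSpace n) ℂ) (M : Matrix (R × QSpace n) (R × QSpace n) ℂ) :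
    blockTrace (layers p R l M) = blockTrace M := by
  induction l generalizing M with
  | nil => rfl
  | cons V l ih =>
    rw [layers_cons, ih fun W hW => hl W (List.mem_cons_of_mem _ hW),
      blockTrace_layer (hl V List.mem_cons_self)]

lemma trace_of_blockTrace_eq [Nonempty R] {A : Type*} [Fintype A] {M : Matrix (R × A) (R × A) ℂ}
    (hM : blockTrace M = ((Fintype.card R : ℂ))⁻¹ • 1) : trace M = 1 := by
  have : (Fintype.card R : ℂ) ≠ 0 := Nat.cast_ne_zero.2 Fintype.card_ne_zero
  rw [← trace_blockTrace, hM, trace_smul, trace_one, smul_eq_mul, inv_mul_cancel₀ this]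

lemma negEnt_twirlSites_sitePauli [Nonempty R] {M : Matrix (R × QSpace n) (R × QSpace n) ℂ}
    (hM : blockTrace M = ((Fintype.card R : ℂ))⁻¹ • 1) :
    negEnt (twirlSites (sitePauli R) (List.finRange n) M) =
      -Real.log (Fintype.card R * 2 ^ n) := by
  have : (Fintype.card R : ℝ) ≠ 0 := Nat.cast_ne_zero.2 Fintype.card_ne_zero
  rw [twirlSites_sitePauli hM, negEnt_smul_one, Real.log_inv]
  rw [Fintype.card_prod]
  simp only [Fintype.card_pi, Fintype.card_fin, Finset.prod_const, Finset.card_univ]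
  push_cast
  field_simp

/-- Each noisy layer contracts the gap between the entropy of a state with uniform reference
marginal and the maximal entropy by `exp (-p)`. -/
theorem negEnt_layers_le [Nonempty R] (hp0 : 0 ≤ p) (hp1 : p ≤ 1)
    {l : List (Matrix (QSpace n) (QSpace n) ℂ)}
    (hl : ∀ V ∈ l, V ∈ unitaryGroup (QSpace n) ℂ) {M : Matrix (R × QSpace n) (R × QSpace n) ℂ}
    (hM : M.PosDef) (hM1 : blockTrace M = ((Fintype.card R : ℂ))⁻¹ • 1) :
    negEnt (layers p R l M) + Real.log (Fintype.card R * 2 ^ n) ≤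
      Real.exp (-(p * l.length)) * (negEnt M + Real.log (Fintype.card R * 2 ^ n)) := by
  induction l generalizing M with
  | nil =>
    simp only [List.length_nil, Nat.cast_zero, mul_zero, neg_zero, Real.exp_zero, one_mul]
    exact le_rfl
  | cons V l ih =>
    have hV := hl V List.mem_cons_self
    have hW := one_kronecker_mem_unitaryGroup (R := R) hV
    set W := (1 : Matrix R R ℂ) ⊗ₖ V
    have hM' : (W * M * Wᴴ).PosDef :=
      (Matrix.IsUnit.posDef_star_right_conjugate_iff (Unitary.toUnits ⟨W, hW⟩).isUnit).2 hM
    have hM1' : blockTrace (W * M * Wᴴ) = ((Fintype.card R : ℂ))⁻¹ • 1 := by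
      rw [← hM1, ← idTensor_conj, blockTrace_idTensor (trace_conj_of_mem_unitaryGroup hV)]
    have h1 := ih (fun W hW => hl W (List.mem_cons_of_mem _ hW))
      (noiseSites_posDef hp0 hp1 sitePauli_mem_unitaryGroup (List.finRange n) hM')
      ((blockTrace_layer hV M).trans hM1)
    have h2 := negEnt_noiseSites_sub_le (Q := sitePauli R) sitePauli_mem_unitaryGroup
      sitePauli_zero sitePauli_mul_twirl (fun i j hij => sitePauli_comm hij) hp0 hp1
      (List.nodup_finRange n) hM'
    rw [negEnt_twirlSites_sitePauli hM1', sub_neg_eq_add, sub_neg_eq_add] at h2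
    have h3 := negEnt_conj_le hW hM (trace_of_blockTrace_eq hM1)
    rw [layers_cons]
    refine h1.trans ?_
    have h4 : Real.exp (-(p * (V :: l).length)) =
        Real.exp (-(p * l.length)) * Real.exp (-p) := by
      rw [← Real.exp_add, List.length_cons]
      push_cast
      ring_nf
    rw [h4, mul_assoc (Real.exp _)]
    refine mul_le_mul_of_nonneg_left (h2.trans ?_) (Real.exp_pos _).le
    exact mul_le_mul_of_nonneg_left (by linarith) (Real.exp_pos _).le

lemma blockTrace_smul_add_smul {A : Type*} [Fintype A] (M N : Matrix (R × A) (R × A) ℂ)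
    (a b : ℂ) : blockTrace (a • M + b • N) = a • blockTrace M + b • blockTrace N := by
  ext r r'
  simp [blockTrace, trace, Finset.sum_add_distrib, Finset.mul_sum]

lemma blockTrace_one : blockTrace (1 : Matrix (R × QSpace n) (R × QSpace n) ℂ) =
    (2 ^ n : ℂ) • 1 := by
  ext r r'
  simp [blockTrace, trace, one_apply]

/-- Lower bound on the entropy (in nats) of the joint output, allowing singular inputs. -/
theorem neg_negEnt_layers_ge [Nonempty R] (hp0 : 0 ≤ p) (hp1 : p ≤ 1)
    {l : List (Matrix (QSpace n) (QSpace n) ℂ)}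
    (hl : ∀ V ∈ l, V ∈ unitaryGroup (QSpace n) ℂ) {M : Matrix (R × QSpace n) (R × QSpace n) ℂ}
    (hM : M.PosSemidef) (hM1 : blockTrace M = ((Fintype.card R : ℂ))⁻¹ • 1) :
    (1 - Real.exp (-(p * l.length))) * Real.log (Fintype.card R * 2 ^ n) ≤
      -negEnt (layers p R l M) := by
  have hR : (Fintype.card R : ℝ) ≠ 0 := Nat.cast_ne_zero.2 Fintype.card_ne_zero
  have hR' : (Fintype.card R : ℂ) ≠ 0 := Nat.cast_ne_zero.2 Fintype.card_ne_zero
  set c : ℝ := (Fintype.card R * 2 ^ n : ℝ)⁻¹ with hc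
  have hlim := tendsto_negEnt_mix (layers_posSemidef hp0 hp1 l hM).1 c
  have hbound : ∀ᶠ ε : ℝ in nhdsWithin 0 (Set.Ioi 0),
      negEnt (((1 - ε : ℝ) : ℂ) • layers p R l M + ((ε * c : ℝ) : ℂ) • 1) ≤
        -((1 - Real.exp (-(p * l.length))) * Real.log (Fintype.card R * 2 ^ n)) := by
    filter_upwards [Ioo_mem_nhdsGT one_pos] with ε hε
    have hc0 : 0 < c := by positivity
    have hpd : (((1 - ε : ℝ) : ℂ) • M + ((ε * c : ℝ) : ℂ) • 1).PosDef :=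
      PosDef.posSemidef_add (posSemidef_ofReal_smul (sub_nonneg.2 hε.2.le) hM)
        (posDef_smul_one (mul_pos hε.1 hc0))
    have hbt : blockTrace (((1 - ε : ℝ) : ℂ) • M + ((ε * c : ℝ) : ℂ) • 1) =
        ((Fintype.card R : ℂ))⁻¹ • 1 := by
      rw [blockTrace_smul_add_smul, hM1, blockTrace_one, smul_smul, smul_smul, ← add_smul, hc]
      congr 1
      push_cast
      field_simp
      ring
    have h1 := negEnt_layers_le hp0 hp1 hl hpd hbt
    have h2 := negEnt_nonpos hpd.posSemidef (trace_of_blockTrace_eq hbt)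
    rw [layers_add_smul_one hl] at h1
    nlinarith [mul_nonneg (Real.exp_pos (-(p * l.length))).le (neg_nonneg.2 h2)]
  have := le_of_tendsto hlim hbound
  linarith

end Circuit

section Encoding

variable {n k : ℕ}

lemma ptraceFirst_posSemidef {R B : Type*} [Fintype R] {M : Matrix (R × B) (R × B) ℂ}
    (hM : M.PosSemidef) : (ptraceFirst M).PosSemidef := by
  have h : ptraceFirst M = ∑ r, M.submatrix (fun b => (r, b)) fun b => (r, b) := by
    ext b b'
    simp [ptraceFirst, Matrix.sum_apply]
  rw [h]
  exact posSemidef_sum _ fun r _ => hM.submatrix _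

lemma trace_ptraceFirst {R B : Type*} [Fintype R] [Fintype B] (M : Matrix (R × B) (R × B) ℂ) :
    trace (ptraceFirst M) = trace M := by
  simp only [trace, ptraceFirst, diag_apply, of_apply, Fintype.sum_prod_type]
  exact Finset.sum_comm

/-- Append ancillas in the state `0` to a computational basis state. -/
def extendZero (n : ℕ) (r : QSpace k) : QSpace n := fun i => if h : (i : ℕ) < k then r ⟨i, h⟩ else 0

/-- The maximally entangled state with ancillas in the state `0` appended to the second factor. -/
def inputState (n k : ℕ) : Matrix (QSpace k × QSpace n) (QSpace k × QSpace n) ℂ :=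
  Matrix.of fun x y => if x.2 = extendZero n x.1 ∧ y.2 = extendZero n y.1 then
    ((Fintype.card (QSpace k) : ℂ))⁻¹ else 0

lemma eq_extendZero_iff (hk : k ≤ n) (r : QSpace k) (x : QSpace n) :
    x = extendZero n r ↔
      (∀ i : Fin n, ¬ (i : ℕ) < k → x i = 0) ∧ r = fun j => x (Fin.castLE hk j) := by
  constructor
  · rintro rfl
    refine ⟨fun i hi => by simp [extendZero, hi], ?_⟩
    funext j
    simp [extendZero]
  · rintro ⟨h, rfl⟩
    funext i
    by_cases hi : (i : ℕ) < k
    · simp [extendZero, hi]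
    · simp [extendZero, hi, h i hi]

lemma idTensor_encode_maxEnt (hk : k ≤ n) :
    idTensor (encode hk id) (maxEnt (QSpace k)) = inputState n k := by
  ext ⟨r, x⟩ ⟨r', y⟩
  have h : ∀ i : Fin n, (if (i : ℕ) < k then (1 : ℂ) else if x i = 0 ∧ y i = 0 then 1 else 0) =
      if (i : ℕ) < k ∨ x i = 0 ∧ y i = 0 then 1 else 0 := fun i => by
    by_cases hi : (i : ℕ) < k <;> simp [hi]
  have h2 : (∀ i : Fin n, (i : ℕ) < k ∨ x i = 0 ∧ y i = 0) ↔
      (∀ i : Fin n, ¬ (i : ℕ) < k → x i = 0) ∧ ∀ i : Fin n, ¬ (i : ℕ) < k → y i = 0 := by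
    rw [← forall_and]
    refine forall_congr' fun i => ?_
    tauto
  simp only [idTensor, encode, maxEnt, inputState, of_apply, id, h, Finset.prod_ite_zero,
    Finset.mem_univ, true_imp_iff, Finset.prod_const_one, h2, eq_extendZero_iff hk, ite_mul,
    one_mul, zero_mul, ← ite_and]
  refine if_congr ?_ rfl rfl
  tauto

lemma inputState_posSemidef : (inputState n k).PosSemidef := by
  let v : QSpace k × QSpace n → ℂ := fun x => if x.2 = extendZero n x.1 then 1 else 0
  have h : inputState n k =
      (((Fintype.card (QSpace k) : ℝ)⁻¹ : ℝ) : ℂ) • vecMulVec v (star v) := by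
    ext x y
    by_cases hx : x.2 = extendZero n x.1 <;> by_cases hy : y.2 = extendZero n y.1 <;>
      simp [inputState, v, vecMulVec_apply, hx, hy]
  rw [h]
  exact posSemidef_ofReal_smul (by positivity) (posSemidef_vecMulVec_self_star v)

lemma blockTrace_inputState (hk : k ≤ n) :
    blockTrace (inputState n k) = ((Fintype.card (QSpace k) : ℂ))⁻¹ • 1 := by
  ext r r'
  rcases eq_or_ne r r' with rfl | hr
  · simp [blockTrace, trace, inputState]
  · have h : ∀ x, ¬ (x = extendZero n r ∧ x = extendZero n r') := fun x hx =>
      hr (((eq_extendZero_iff hk r x).1 hx.1).2.trans ((eq_extendZero_iff hk r' x).1 hx.2).2.symm)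
    simp [blockTrace, trace, inputState, h, hr]

end Encoding

end Preliminaries

/-- For any depth-`d` noisy circuit on `n` qubits (arbitrary unitary layers
interspersed with depolarizing noise of strength `p` on every qubit), the coherent information
of the induced encoding channel on the maximally mixed input satisfies
`I_c ≤ e^{−pd}(n + k) − k`. -/
theorem coherent_info_upper_bound
    (n k d : ℕ) (p : ℝ) (hk1 : 1 ≤ k) (hkn : k ≤ n) (hd : 1 ≤ d)
    (hp0 : 0 < p) (hp1 : p < 1)
    (U : Fin d → Matrix (QSpace n) (QSpace n) ℂ)
    (hU : ∀ i, U i ∈ Matrix.unitaryGroup (QSpace n) ℂ) :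
    cohInfo (encode hkn (noisyCircuit p U)) ≤
      Real.exp (-(p * d)) * ((n : ℝ) + k) - k := by
  have hl : ∀ V ∈ List.ofFn U, V ∈ unitaryGroup (QSpace n) ℂ := by
    intro V hV
    obtain ⟨i, rfl⟩ := List.mem_ofFn.1 hV
    exact hU i
  have hout : idTensor (R := QSpace k) (encode hkn (noisyCircuit p U)) (maxEnt (QSpace k)) =
      layers p (QSpace k) (List.ofFn U) (inputState n k) := by
    rw [← idTensor_encode_maxEnt hkn]
    rfl
  have hpsd := layers_posSemidef hp0.le hp1.le (List.ofFn U)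
    (inputState_posSemidef (n := n) (k := k))
  have htr := trace_of_blockTrace_eq
    ((blockTrace_layers (p := p) hl _).trans (blockTrace_inputState hkn))
  have hRB := neg_negEnt_layers_ge hp0.le hp1.le hl inputState_posSemidef
    (blockTrace_inputState hkn)
  have hB := neg_negEnt_le (ptraceFirst_posSemidef hpsd) ((trace_ptraceFirst _).trans htr)
  have h2 : 0 < Real.log 2 := Real.log_pos one_lt_two
  rw [cohInfo, hout, vN_eq (ptraceFirst_posSemidef hpsd).1, vN_eq hpsd.1]
  rw [List.length_ofFn] at hRB
  simp only [Fintype.card_pi, Fintype.card_fin, Finset.prod_const, Finset.card_univ, Nat.cast_pow,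
    Nat.cast_ofNat, ← pow_add, Real.log_pow, Nat.cast_add] at hRB hB
  rw [← sub_div, div_le_iff₀ h2]
  linarith
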